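/- Let D be a simply connected domain of an n-dimensional 2-symmetric Lorentzian manifold (V,g). If there is no null parallel vector field on D, then (D,g) is either Ricci-flat (R_{μν} = 0 on D) or locally symmetric (∇_μ R^{α}_{βγδ} = 0 on D). -/

import Mathlib

noncomputable section

open scoped BigOperators

/-! ## A local-coordinate framework for semi-Riemannian geometry

A semi-Riemannian manifold is described in a local chart: points are elements of
`Pt n := Fin n → ℝ`, a rank-`q` covariant tensor field is a map
`Pt n → (Fin q → Fin n) → ℝ`, the metric `g` (with inverse `ginv`) determines the
Christoffel symbols of its Levi-Civita connection, the covariant derivative `covD`,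
and the Riemann, Ricci, scalar and Weyl curvatures. -/

/-- Points of a local chart of an `n`-dimensional manifold. -/
abbrev Pt (n : ℕ) : Type := Fin n → ℝ

/-- A rank-`q` (covariant) tensor field, in the chart. -/
abbrev Tensor (n q : ℕ) : Type := Pt n → (Fin q → Fin n) → ℝ

/-- Partial derivative of a scalar field in the `i`-th coordinate direction. -/
def pd {n : ℕ} (i : Fin n) (f : Pt n → ℝ) (x : Pt n) : ℝ :=
  fderiv ℝ f x (Pi.single i 1)

/-- `g` is a smooth metric of arbitrary signature, with (smooth) inverse `ginv`. -/
def IsMetric {n : ℕ} (g ginv : Pt n → Fin n → Fin n → ℝ) : Prop :=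
  (∀ x μ ν, g x μ ν = g x ν μ) ∧
  (∀ μ ν, ContDiff ℝ (⊤ : ℕ∞) fun x => g x μ ν) ∧
  (∀ μ ν, ContDiff ℝ (⊤ : ℕ∞) fun x => ginv x μ ν) ∧
  (∀ x μ ν, (∑ ρ, ginv x μ ρ * g x ρ ν) = if μ = ν then (1 : ℝ) else 0)

/-- The metric `g` has Lorentzian signature `(-,+,…,+)`: at every point there is a
frame in which it takes the form `diag (-1, 1, …, 1)`. -/
def IsLorentzian {n : ℕ} (g : Pt n → Fin n → Fin n → ℝ) : Prop :=
  ∀ x, ∃ e : Fin n → Fin n → ℝ, ∀ μ ν : Fin n,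
    (∑ α, ∑ β, g x α β * e μ α * e ν β) =
      if μ = ν then (if μ.val = 0 then (-1 : ℝ) else 1) else 0

/-- Christoffel symbols `Γ^α_{βγ}` of the Levi-Civita connection of `g`. -/
def christoffel {n : ℕ} (g ginv : Pt n → Fin n → Fin n → ℝ) (x : Pt n) (α β γ : Fin n) : ℝ :=
  (1 / 2) * ∑ ρ, ginv x α ρ *
    (pd β (fun y => g y ρ γ) x + pd γ (fun y => g y ρ β) x - pd ρ (fun y => g y β γ) x)

/-- Covariant derivative of a rank-`q` covariant tensor field:
`(covD T)_{λ α₁ … α_q} = ∇_λ T_{α₁ … α_q}`; the derivative index comes first. -/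
def covD {n q : ℕ} (g ginv : Pt n → Fin n → Fin n → ℝ) (T : Tensor n q) :
    Tensor n (q + 1) := fun x idx =>
  pd (idx 0) (fun y => T y fun i => idx i.succ) x -
    ∑ i : Fin q, ∑ ρ, christoffel g ginv x ρ (idx 0) (idx i.succ) *
      T x (Function.update (fun j => idx j.succ) i ρ)

/-- Covariant derivative `∇_λ k^μ` of a vector field `k^μ`. -/
def covDVec {n : ℕ} (g ginv : Pt n → Fin n → Fin n → ℝ) (k : Pt n → Fin n → ℝ)
    (x : Pt n) (lam μ : Fin n) : ℝ :=
  pd lam (fun y => k y μ) x + ∑ ρ, christoffel g ginv x μ lam ρ * k x ρ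

/-- Riemann curvature tensor `R^α_{βγδ}` of the Levi-Civita connection of `g`. -/
def riemannUp {n : ℕ} (g ginv : Pt n → Fin n → Fin n → ℝ) (x : Pt n) (α β γ δ : Fin n) : ℝ :=
  pd γ (fun y => christoffel g ginv y α δ β) x - pd δ (fun y => christoffel g ginv y α γ β) x +
    ∑ ρ, (christoffel g ginv x α γ ρ * christoffel g ginv x ρ δ β -
          christoffel g ginv x α δ ρ * christoffel g ginv x ρ γ β)

/-- Fully covariant Riemann tensor `R_{αβγδ} = g_{αρ} R^ρ_{βγδ}`. -/
def riemann {n : ℕ} (g ginv : Pt n → Fin n → Fin n → ℝ) : Tensor n 4 := fun x idx =>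
  ∑ ρ, g x (idx 0) ρ * riemannUp g ginv x ρ (idx 1) (idx 2) (idx 3)

/-- Ricci tensor `R_{μν} = R^ρ_{μρν}`. -/
def ricci {n : ℕ} (g ginv : Pt n → Fin n → Fin n → ℝ) : Tensor n 2 := fun x idx =>
  ∑ ρ, riemannUp g ginv x ρ (idx 0) ρ (idx 1)

/-- Scalar curvature `R = g^{μν} R_{μν}`. -/
def scalarCurv {n : ℕ} (g ginv : Pt n → Fin n → Fin n → ℝ) (x : Pt n) : ℝ :=
  ∑ μ, ∑ ν, ginv x μ ν * ricci g ginv x ![μ, ν]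

/-- Weyl conformal tensor `C_{αβλμ}`, defined through the standard decomposition
`R_{αβλμ} = C_{αβλμ} + (2/(n-2)) (R_{α[λ} g_{μ]β} - R_{β[λ} g_{μ]α})
 - (R/((n-1)(n-2))) (g_{αλ} g_{βμ} - g_{αμ} g_{βλ})`. -/
def weyl {n : ℕ} (g ginv : Pt n → Fin n → Fin n → ℝ) : Tensor n 4 := fun x idx =>
  riemann g ginv x idx -
    (2 / ((n : ℝ) - 2)) *
      ((ricci g ginv x ![idx 0, idx 2] * g x (idx 3) (idx 1) -
        ricci g ginv x ![idx 0, idx 3] * g x (idx 2) (idx 1)) / 2 -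
       (ricci g ginv x ![idx 1, idx 2] * g x (idx 3) (idx 0) -
        ricci g ginv x ![idx 1, idx 3] * g x (idx 2) (idx 0)) / 2) +
    (scalarCurv g ginv x / (((n : ℝ) - 1) * ((n : ℝ) - 2))) *
      (g x (idx 0) (idx 2) * g x (idx 1) (idx 3) - g x (idx 0) (idx 3) * g x (idx 1) (idx 2))

/-- Second-order symmetry (2-symmetry): `∇_μ ∇_ν R_{αβγδ} = 0` everywhere. -/
def TwoSymmetric {n : ℕ} (g ginv : Pt n → Fin n → Fin n → ℝ) : Prop :=
  ∀ x idx, covD g ginv (covD g ginv (riemann g ginv)) x idx = 0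

/-- 2-symmetry on a set `D`: `∇_μ ∇_ν R_{αβγδ} = 0` on `D`. -/
def TwoSymmetricOn {n : ℕ} (g ginv : Pt n → Fin n → Fin n → ℝ) (D : Set (Pt n)) : Prop :=
  ∀ x ∈ D, ∀ idx, covD g ginv (covD g ginv (riemann g ginv)) x idx = 0

/-- Semi-symmetry: `∇_[μ ∇_ν] R_{αβγδ} = 0` everywhere. -/
def SemiSymmetric {n : ℕ} (g ginv : Pt n → Fin n → Fin n → ℝ) : Prop :=
  ∀ x (μ ν α β γ δ : Fin n),
    covD g ginv (covD g ginv (riemann g ginv)) x ![μ, ν, α, β, γ, δ] =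
    covD g ginv (covD g ginv (riemann g ginv)) x ![ν, μ, α, β, γ, δ]

/-- `p` is a generic point: the Riemann tensor at `p`, viewed as the endomorphism
`ω_{γδ} ↦ R^{αβ}_{γδ} ω_{γδ}` of the space of 2-forms at `p`, is non-singular. -/
def GenericAt {n : ℕ} (g ginv : Pt n → Fin n → Fin n → ℝ) (p : Pt n) : Prop :=
  ∀ ω : Fin n → Fin n → ℝ, (∀ γ δ, ω γ δ = -ω δ γ) →
    (∀ α β, (∑ γ, ∑ δ, (∑ σ, ginv p β σ * riemannUp g ginv p α σ γ δ) * ω γ δ) = 0) →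
    ω = 0

/-- `k` is a parallel null (nowhere zero) vector field on `D`. -/
def ParallelNullVectorFieldOn {n : ℕ} (g ginv : Pt n → Fin n → Fin n → ℝ)
    (D : Set (Pt n)) (k : Pt n → Fin n → ℝ) : Prop :=
  (∀ x ∈ D, ∀ lam μ, covDVec g ginv k x lam μ = 0) ∧
  (∀ x ∈ D, (∑ μ, ∑ ν, g x μ ν * k x μ * k x ν) = 0) ∧
  (∀ x ∈ D, k x ≠ 0)

/-- Pullback metric of `g` along a coordinate change `φ`. -/
def pullback {n : ℕ} (g : Pt n → Fin n → Fin n → ℝ) (φ : Pt n → Pt n)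
    (x : Pt n) (μ ν : Fin n) : ℝ :=
  ∑ α, ∑ β, g (φ x) α β * pd μ (fun y => φ y α) x * pd ν (fun y => φ y β) x

/-- `k`-th iterated covariant derivative of a rank-`q` tensor field. -/
def covDIter {n : ℕ} (g ginv : Pt n → Fin n → Fin n → ℝ) (q : ℕ) :
    (k : ℕ) → Tensor n q → Tensor n (q + k)
  | 0, T => T
  | k + 1, T => covD g ginv (covDIter g ginv q k T)

/-- Totally antisymmetric Levi-Civita symbol. -/
def lcSymbol {n : ℕ} (idx : Fin n → Fin n) : ℝ :=
  if h : Function.Bijective idx then ((Equiv.Perm.sign (Equiv.ofBijective idx h) : ℤ) : ℝ) else 0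

/-- The metric volume element `n`-form `√|det g| ε_{μ₁…μ_n}`. -/
def volForm {n : ℕ} (g : Pt n → Fin n → Fin n → ℝ) : Tensor n n := fun x idx =>
  Real.sqrt |Matrix.det (Matrix.of (g x))| * lcSymbol idx

/-- Formal curvature invariants of rank `q`: tensor fields constructed polynomially
from the metric, its inverse, the Riemann tensor, the volume `n`-form, covariant
derivatives, tensor products, (metric) contractions, index permutations, sums and
scalar multiples. -/
inductive TExpr (n : ℕ) : ℕ → Type where
  | metric : TExpr n 2
  | inv : TExpr n 2
  | riem : TExpr n 4
  | eps : TExpr n n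
  | cd : {q : ℕ} → TExpr n q → TExpr n (q + 1)
  | tprod : {q r : ℕ} → TExpr n q → TExpr n r → TExpr n (q + r)
  | contr : {q : ℕ} → TExpr n (q + 2) → TExpr n q
  | permute : {q : ℕ} → Equiv.Perm (Fin q) → TExpr n q → TExpr n q
  | add : {q : ℕ} → TExpr n q → TExpr n q → TExpr n q
  | smul : {q : ℕ} → ℝ → TExpr n q → TExpr n q

/-- Evaluation of a formal curvature invariant as a tensor field. -/
def TExpr.eval {n : ℕ} (g ginv : Pt n → Fin n → Fin n → ℝ) :
    {q : ℕ} → TExpr n q → Tensor n q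
  | _, .metric => fun x idx => g x (idx 0) (idx 1)
  | _, .inv => fun x idx => ginv x (idx 0) (idx 1)
  | _, .riem => riemann g ginv
  | _, .eps => volForm g
  | _, .cd e => covD g ginv (TExpr.eval g ginv e)
  | _, .tprod e₁ e₂ => fun x idx =>
      TExpr.eval g ginv e₁ x (fun i => idx (Fin.castAdd _ i)) *
      TExpr.eval g ginv e₂ x (fun i => idx (Fin.natAdd _ i))
  | _, .contr e => fun x idx =>
      ∑ ρ, ∑ σ, ginv x ρ σ * TExpr.eval g ginv e x (Fin.cons ρ (Fin.cons σ idx))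
  | _, .permute π e => fun x idx => TExpr.eval g ginv e x (idx ∘ π)
  | _, .add e₁ e₂ => fun x idx => TExpr.eval g ginv e₁ x idx + TExpr.eval g ginv e₂ x idx
  | _, .smul c e => fun x idx => c * TExpr.eval g ginv e x idx

/-- `e.HasOrderDeg m d`: the invariant `e` is homogeneous of order `m` (number of
covariant derivatives in each term) and degree `d` (number of Riemann factors in
each term). -/
inductive TExpr.HasOrderDeg {n : ℕ} : {q : ℕ} → TExpr n q → ℕ → ℕ → Prop where
  | metric : HasOrderDeg .metric 0 0
  | inv : HasOrderDeg .inv 0 0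
  | riem : HasOrderDeg .riem 0 1
  | eps : HasOrderDeg .eps 0 0
  | cd {q : ℕ} {e : TExpr n q} {m d : ℕ} : HasOrderDeg e m d → HasOrderDeg e.cd (m + 1) d
  | tprod {q r : ℕ} {e₁ : TExpr n q} {e₂ : TExpr n r} {m₁ d₁ m₂ d₂ : ℕ} :
      HasOrderDeg e₁ m₁ d₁ → HasOrderDeg e₂ m₂ d₂ →
      HasOrderDeg (e₁.tprod e₂) (m₁ + m₂) (d₁ + d₂)
  | contr {q : ℕ} {e : TExpr n (q + 2)} {m d : ℕ} : HasOrderDeg e m d → HasOrderDeg e.contr m d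
  | permute {q : ℕ} {π : Equiv.Perm (Fin q)} {e : TExpr n q} {m d : ℕ} :
      HasOrderDeg e m d → HasOrderDeg (e.permute π) m d
  | add {q : ℕ} {e₁ e₂ : TExpr n q} {m d : ℕ} :
      HasOrderDeg e₁ m d → HasOrderDeg e₂ m d → HasOrderDeg (e₁.add e₂) m d
  | smul {q : ℕ} {c : ℝ} {e : TExpr n q} {m d : ℕ} :
      HasOrderDeg e m d → HasOrderDeg (e.smul c) m d

/-- `P` is the parallel-transport operator along the curve `γ`. -/
def IsTransportAlong {n : ℕ} (g ginv : Pt n → Fin n → Fin n → ℝ)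
    (γ : ℝ → Pt n) (P : ℝ → Fin n → Fin n → ℝ) : Prop :=
  (∀ μ ν, P 0 μ ν = if μ = ν then (1 : ℝ) else 0) ∧
  ∀ t μ ν, HasDerivAt (fun s => P s μ ν)
    (-∑ lam, ∑ ρ, christoffel g ginv (γ t) μ lam ρ * deriv (fun s => γ s lam) t * P t ρ ν) t

/-- The subspace `W` of the tangent space at `p` is invariant under the holonomy
group of `(D, g)` at `p` (parallel transport around smooth loops in `D` based at `p`). -/
def HolonomyInvariantAt {n : ℕ} (g ginv : Pt n → Fin n → Fin n → ℝ) (D : Set (Pt n))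
    (p : Pt n) (W : Submodule ℝ (Fin n → ℝ)) : Prop :=
  ∀ γ : ℝ → Pt n, ContDiff ℝ (⊤ : ℕ∞) γ → (∀ t, γ t ∈ D) → γ 0 = p → γ 1 = p →
    ∀ P, IsTransportAlong g ginv γ P →
      ∀ w ∈ W, (fun μ => ∑ ν, P 1 μ ν * w ν) ∈ W

/-- The holonomy group of `(D,g)` at `p` is reducible: it leaves invariant a
non-trivial subspace of the tangent space. -/
def ReducibleAt {n : ℕ} (g ginv : Pt n → Fin n → Fin n → ℝ) (D : Set (Pt n))
    (p : Pt n) : Prop :=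
  ∃ W : Submodule ℝ (Fin n → ℝ), W ≠ ⊥ ∧ W ≠ ⊤ ∧ HolonomyInvariantAt g ginv D p W

/-- The holonomy group of `(D,g)` at `p` is non-degenerately reducible: it leaves
invariant a non-trivial subspace on which `g` is non-degenerate. -/
def NonDegReducibleAt {n : ℕ} (g ginv : Pt n → Fin n → Fin n → ℝ) (D : Set (Pt n))
    (p : Pt n) : Prop :=
  ∃ W : Submodule ℝ (Fin n → ℝ), W ≠ ⊥ ∧ W ≠ ⊤ ∧ HolonomyInvariantAt g ginv D p W ∧
    ∀ w ∈ W, (∀ u ∈ W, (∑ μ, ∑ ν, g p μ ν * w μ * u ν) = 0) → w = 0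

section LorentzAlgebra

open Module

variable {V : Type*} [NormedAddCommGroup V] [NormedSpace ℝ V] {ι : Type*} [Fintype ι]
  [DecidableEq ι]

/-- `b` is an orthonormal basis for the form `G` of signature `(-,+,…,+)`, with `b i₀` timelike. -/
def IsLorentzBasis (G : V →L[ℝ] V →L[ℝ] ℝ) (b : Basis ι ℝ V) (i₀ : ι) : Prop :=
  ∀ i j, G (b i) (b j) = if i = j then (if i = i₀ then (-1 : ℝ) else 1) else 0

namespace IsLorentzBasis

variable {G : V →L[ℝ] V →L[ℝ] ℝ} {b : Basis ι ℝ V} {i₀ : ι}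

lemma apply_basis (h : IsLorentzBasis G b i₀) (v : V) (j : ι) :
    G v (b j) = (if j = i₀ then (-1 : ℝ) else 1) * b.repr v j := by
  conv_lhs => rw [← b.sum_repr v]
  simp only [map_sum, map_smul, sum_apply, smul_apply,
    h _ j, smul_eq_mul, mul_ite, mul_zero]
  rw [Finset.sum_ite_eq' Finset.univ j]
  simp

lemma repr_eq (h : IsLorentzBasis G b i₀) (v : V) (j : ι) :
    b.repr v j = (if j = i₀ then (-1 : ℝ) else 1) * G v (b j) := by
  rw [h.apply_basis]; split_ifs <;> ring

lemma apply_apply (h : IsLorentzBasis G b i₀) (v w : V) :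
    G v w = ∑ j, (if j = i₀ then (-1 : ℝ) else 1) * (b.repr v j * b.repr w j) := by
  conv_lhs => rw [← b.sum_repr w]
  simp only [map_sum, map_smul, smul_eq_mul, h.apply_basis]
  exact Finset.sum_congr rfl fun j _ => by ring

lemma symm (h : IsLorentzBasis G b i₀) (v w : V) : G v w = G w v := by
  rw [h.apply_apply, h.apply_apply]
  exact Finset.sum_congr rfl fun j _ => by ring

lemma eq_zero (h : IsLorentzBasis G b i₀) {v : V} (hv : ∀ w, G v w = 0) : v = 0 := by
  apply b.repr.injective
  ext j
  simp [h.repr_eq, hv]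

lemma apply_self_of_orthogonal (h : IsLorentzBasis G b i₀) {v : V} (hv : G v (b i₀) = 0) :
    G v v = ∑ j, b.repr v j ^ 2 := by
  have h0 : b.repr v i₀ = 0 := by rw [h.repr_eq, hv, mul_zero]
  rw [h.apply_apply]
  refine Finset.sum_congr rfl fun j _ => ?_
  split_ifs with hj
  · subst hj; simp [h0]
  · ring

lemma apply_self_nonneg (h : IsLorentzBasis G b i₀) {v : V} (hv : G v (b i₀) = 0) :
    0 ≤ G v v := by
  rw [h.apply_self_of_orthogonal hv]; positivity

lemma eq_zero_of_orthogonal (h : IsLorentzBasis G b i₀) {v : V} (hv : G v (b i₀) = 0)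
    (hvv : G v v = 0) : v = 0 := by
  rw [h.apply_self_of_orthogonal hv, Finset.sum_eq_zero_iff_of_nonneg fun _ _ => sq_nonneg _] at hvv
  apply b.repr.injective
  ext j
  simpa using hvv j (Finset.mem_univ j)

lemma apply_timelike_ne_zero (h : IsLorentzBasis G b i₀) {k : V} (hk : k ≠ 0) (hkk : G k k = 0) :
    G k (b i₀) ≠ 0 := fun h0 => hk (h.eq_zero_of_orthogonal h0 hkk)

lemma exists_smul_of_null (h : IsLorentzBasis G b i₀) {k v : V} (hk : k ≠ 0) (hkk : G k k = 0)
    (hvv : G v v = 0) (hkv : G k v = 0) : ∃ c : ℝ, v = c • k := by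
  have h0 := h.apply_timelike_ne_zero hk hkk
  refine ⟨G v (b i₀) / G k (b i₀), sub_eq_zero.1 (h.eq_zero_of_orthogonal ?_ ?_)⟩
  · simp [h0]
  · simp [hkk, hvv, hkv, h.symm v k]

lemma trace_eq (h : IsLorentzBasis G b i₀) (f : V →ₗ[ℝ] V) :
    LinearMap.trace ℝ V f = ∑ j, (if j = i₀ then (-1 : ℝ) else 1) * G (f (b j)) (b j) := by
  rw [LinearMap.trace_eq_matrix_trace ℝ b, Matrix.trace]
  exact Finset.sum_congr rfl fun j _ => by
    rw [Matrix.diag_apply, LinearMap.toMatrix_apply, h.repr_eq]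

lemma trace_sq (h : IsLorentzBasis G b i₀) (f : V →ₗ[ℝ] V) (hf : ∀ u v, G (f u) v = G u (f v))
    (h0 : f (b i₀) = 0) : LinearMap.trace ℝ V (f * f) = ∑ j, G (f (b j)) (f (b j)) := by
  rw [h.trace_eq]
  refine Finset.sum_congr rfl fun j _ => ?_
  rw [Module.End.mul_apply, hf]
  split_ifs with hj
  · subst hj; simp [h0]
  · ring

lemma trace_sq_nonneg (h : IsLorentzBasis G b i₀) (f : V →ₗ[ℝ] V)
    (hf : ∀ u v, G (f u) v = G u (f v)) (h0 : f (b i₀) = 0) :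
    0 ≤ LinearMap.trace ℝ V (f * f) := by
  rw [h.trace_sq f hf h0]
  exact Finset.sum_nonneg fun j _ => h.apply_self_nonneg (by rw [hf, h0, map_zero])

lemma eq_zero_of_trace_sq (h : IsLorentzBasis G b i₀) (f : V →ₗ[ℝ] V)
    (hf : ∀ u v, G (f u) v = G u (f v)) (h0 : f (b i₀) = 0)
    (htr : LinearMap.trace ℝ V (f * f) = 0) : f = 0 := by
  have horth : ∀ j, G (f (b j)) (b i₀) = 0 := fun j => by rw [hf, h0, map_zero]
  rw [h.trace_sq f hf h0,
    Finset.sum_eq_zero_iff_of_nonneg fun j _ => h.apply_self_nonneg (horth j)] at htr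
  exact b.ext fun j => by
    simpa using h.eq_zero_of_orthogonal (horth j) (htr j (Finset.mem_univ j))

end IsLorentzBasis

/-- The algebraic identities satisfied at each point by the covariant derivative `T` of the
curvature of a second-order symmetric metric `G`; here `T e x y z = (∇_e R)(x, y) z`. -/
structure IsTwoSymmetricJet (G : V →L[ℝ] V →L[ℝ] ℝ)
    (T : V →L[ℝ] V →L[ℝ] V →L[ℝ] V →L[ℝ] V) : Prop where
  antisymm : ∀ e x y z, T e x y z = -T e y x z
  skew : ∀ e x y z w, G (T e x y z) w = -G z (T e x y w)
  bianchi : ∀ e x y z, T e x y z + T e y z x + T e z x y = 0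
  second_bianchi : ∀ e x y z, T e x y z + T x y e z + T y e x z = 0
  null_index : ∀ v w x y x' y' z, T (T v x y w) x' y' z + T (T w x y v) x' y' z = 0

/-- The Jacobi operator `y ↦ T v y v v`. -/
def jacobi (T : V →L[ℝ] V →L[ℝ] V →L[ℝ] V →L[ℝ] V) (v : V) : V →L[ℝ] V :=
  ((T v).flip v).flip v

@[simp] lemma jacobi_apply (T : V →L[ℝ] V →L[ℝ] V →L[ℝ] V →L[ℝ] V) (v y : V) :
    jacobi T v y = T v y v v := rfl

namespace IsTwoSymmetricJet

variable {G : V →L[ℝ] V →L[ℝ] ℝ} {T : V →L[ℝ] V →L[ℝ] V →L[ℝ] V →L[ℝ] V}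
  {b : Basis ι ℝ V} {i₀ : ι}

lemma pair_symm (hT : IsTwoSymmetricJet G T) (hG : ∀ u v, G u v = G v u) (e x y z w : V) :
    G (T e x y z) w = G (T e z w x) y := by
  have B : ∀ x y z w, G (T e x y z) w + G (T e y z x) w + G (T e z x y) w = 0 := fun x y z w => by
    rw [← add_apply, ← add_apply, ← map_add, ← map_add,
      hT.bianchi, map_zero, zero_apply]
  have A : ∀ x y z w, G (T e x y z) w = -G (T e y x z) w := fun x y z w => by
    rw [hT.antisymm, map_neg, neg_apply]
  have S : ∀ x y z w, G (T e x y z) w = -G (T e x y w) z := fun x y z w => by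
    rw [hT.skew, hG]
  linarith [B x y z w, B y z w x, B z w x y, B w x y z, A x y z w, A y z w x, A z w x y, A w x y z,
    S x y z w, S y z w x, S z w x y, S w x y z, A x z y w, A x w y z, S x z y w, S x w y z,
    A y w x z, S y w x z, A z x y w, A w y x z, A z x w y, A x z w y, S w y x z, S z x y w,
    S y x z w, S z y x w, S w z x y, S x w y z, S x w z y, A y w z x, S y w z x, A w z y x]

variable {b : Basis ι ℝ V} {i₀ : ι}

lemma swap_of_orthogonal_ker (hT : IsTwoSymmetricJet G T) (hb : IsLorentzBasis G b i₀)
    {w : V} (hw : ∀ v, T v = 0 → G v w = 0) (u v z : V) : (2 : ℝ) • T v u w z = T w u v z := by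
  have h1 : T v u w z + T u v w z = 0 := by
    refine hb.eq_zero fun y => ?_
    have h := hw (T v z y u + T u z y v) (by ext; simp [hT.null_index])
    rw [map_add, add_apply, hT.pair_symm hb.symm v z y u w, hT.pair_symm hb.symm u z y v w] at h
    rw [map_add, add_apply, h]
  have h2 := hT.second_bianchi v u w z
  rw [hT.antisymm u w v] at h2
  have h3 : T w v u z = - T w u v z := hT.antisymm w v u z
  rw [h3] at h2
  have h4 : T u v w z = - T v u w z := by rw [eq_neg_iff_add_eq_zero, add_comm, h1]
  rw [h4, neg_neg] at h2
  rw [two_smul, ← sub_eq_zero, ← h2]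
  abel

/-- The structure theorem: a nonzero jet determines a null vector `k` such that
`T e` only depends on `G k e`, and `T` vanishes on `k` and on pairs of vectors orthogonal to `k`. -/
lemma exists_null (hT : IsTwoSymmetricJet G T) (hb : IsLorentzBasis G b i₀) (hT0 : T ≠ 0) :
    ∃ k : V, k ≠ 0 ∧ G k k = 0 ∧ (∀ v, G k v = 0 → T v = 0) ∧ (∀ e v, T e v k = 0) ∧
      ∀ e u v, G k u = 0 → G k v = 0 → T e u v = 0 := by
  have : FiniteDimensional ℝ V := b.finiteDimensional_of_finite
  let B : LinearMap.BilinForm ℝ V := LinearMap.mk₂ ℝ (fun u v => G u v) (by simp) (by simp)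
    (by simp) (by simp)
  have hBG : ∀ u v, B u v = G u v := fun _ _ => rfl
  have hBn : B.Nondegenerate := ⟨fun v hv => hb.eq_zero hv,
    fun v hv => hb.eq_zero fun w => by rw [hb.symm]; exact hv w⟩
  have hBs : B.IsRefl := fun u v h => by rw [hBG, hb.symm]; exact h
  let N : Submodule ℝ V := T.ker
  let W : Submodule ℝ V := B.orthogonal N
  have hN : ∀ v, v ∈ N ↔ T v = 0 := fun v => Iff.rfl
  have hW : ∀ w ∈ W, ∀ v, T v = 0 → G v w = 0 := fun w hw v hv => hw v hv
  have hNW : B.orthogonal W = N := B.orthogonal_orthogonal hBn hBs N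
  have hs := fun {w} (hw : w ∈ W) => hT.swap_of_orthogonal_ker hb (hW w hw)
  have hWW : ∀ w ∈ W, ∀ v ∈ W, ∀ u, T w u v = 0 := fun w hw v hv u => by
    ext1 z
    have h1 := hs hw u v z
    have h2 := hs hv u w z
    rw [← h1, smul_smul] at h2
    have h3 : (3 : ℝ) • T v u w z = 0 := by
      rw [← sub_eq_zero] at h2
      rw [← h2]
      module
    have h4 : T v u w z = 0 := by simpa using h3
    rw [← h1, h4, smul_zero, zero_apply]
  have hWN : ∀ w ∈ W, ∀ v ∈ N, ∀ u, T w u v = 0 := fun w hw v hv u => by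
    ext1 z
    rw [← hs hw u v z, (hN v).1 hv]; simp
  have hsup : ∀ w ∈ W, ∀ v ∈ W ⊔ N, ∀ u, T w u v = 0 := fun w hw v hv u => by
    obtain ⟨v₁, h₁, v₂, h₂, rfl⟩ := Submodule.mem_sup.1 hv
    rw [map_add, hWW w hw v₁ h₁, hWN w hw v₂ h₂, add_zero]
  have hdim : finrank ℝ W = finrank ℝ V - finrank ℝ N := B.finrank_orthogonal hBn N
  have hNle : finrank ℝ N ≤ finrank ℝ V := N.finrank_le
  have hsi := Submodule.finrank_sup_add_finrank_inf_eq W N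
  have hNtop : N ≠ ⊤ := fun h => hT0 (by
    ext1 v; exact (hN v).1 (h ▸ Submodule.mem_top))
  have hinf : W ⊓ N ≠ ⊥ := fun hbot => by
    rw [hbot, finrank_bot] at hsi
    have htop : W ⊔ N = ⊤ := Submodule.eq_top_of_finrank_eq (by omega)
    have hle : W ≤ N := fun w hw => by
      rw [hN]; ext1 u; ext1 v
      exact hsup w hw v (htop ▸ Submodule.mem_top) u
    rw [inf_eq_left.2 hle] at hbot
    rw [hbot, finrank_bot] at hdim
    exact hNtop (Submodule.eq_top_of_finrank_eq (by omega))
  obtain ⟨k, ⟨hkW, hkN⟩, hk⟩ := (Submodule.ne_bot_iff _).1 hinf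
  have hkk : G k k = 0 := hW k hkW k hkN
  have hspan : ∀ v ∈ W ⊓ N, ∃ c : ℝ, v = c • k := fun v hv =>
    hb.exists_smul_of_null hk hkk (hW v hv.1 v hv.2) (hW v hv.1 k hkN)
  have hrank : finrank ℝ (W ⊓ N : Submodule ℝ V) ≤ 1 := by
    have hle : W ⊓ N ≤ ℝ ∙ k := fun v hv => by
      obtain ⟨c, rfl⟩ := hspan v hv
      exact Submodule.smul_mem _ _ (Submodule.mem_span_singleton_self k)
    exact (Submodule.finrank_mono hle).trans (finrank_span_singleton hk).le
  have hrankK : finrank ℝ (B.orthogonal (ℝ ∙ k)) = finrank ℝ V - 1 := by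
    rw [B.finrank_orthogonal hBn, finrank_span_singleton hk]
  have hsupK : W ⊔ N = B.orthogonal (ℝ ∙ k) := by
    refine Submodule.eq_of_le_of_finrank_le (sup_le ?_ ?_) (by omega)
    · refine fun w hw u hu => ?_
      obtain ⟨c, rfl⟩ := Submodule.mem_span_singleton.1 hu
      exact hW w hw _ (N.smul_mem c hkN)
    · refine fun v hv u hu => ?_
      obtain ⟨c, rfl⟩ := Submodule.mem_span_singleton.1 hu
      refine hBs _ _ (hW _ (W.smul_mem c hkW) v hv)
  have hperp : ∀ w ∈ W, ∀ v, G k v = 0 → ∀ u, T w u v = 0 := fun w hw v hv u => by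
    refine hsup w hw v ?_ u
    rw [hsupK]
    intro y hy
    obtain ⟨c, rfl⟩ := Submodule.mem_span_singleton.1 hy
    change G (c • k) v = 0
    simp [hv]
  have h0 := hb.apply_timelike_ne_zero hk hkk
  have hWle : W ≤ N := fun w hw => by
    have hred : ∀ u v, T w u v = (G k v / G k (b i₀)) • T w u (b i₀) := fun u v => by
      rw [← map_smul, ← sub_eq_zero, ← map_sub]
      exact hperp w hw _ (by simp [h0]) u
    have hself : T w (b i₀) (b i₀) = 0 := by
      ext1 z
      have := hT.antisymm w (b i₀) (b i₀) z
      rw [eq_neg_iff_add_eq_zero, ← two_smul ℝ] at this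
      simpa using this
    rw [hN]; ext u v z
    rw [hred, smul_apply, hT.antisymm, hred, hself]; simp
  have hWk : ∀ w ∈ W, ∃ c : ℝ, w = c • k := fun w hw => hspan w ⟨hw, hWle hw⟩
  have hperpN : ∀ v, G k v = 0 → T v = 0 := fun v hv => by
    rw [← hN, ← hNW]
    intro w hw
    obtain ⟨c, rfl⟩ := hWk w hw
    change G (c • k) v = 0
    simp [hv]
  refine ⟨k, hk, hkk, hperpN, fun e v => ?_, fun e u v hu hv => ?_⟩
  · ext1 z
    have h := hs hkW v e z
    rw [(hN k).1 hkN] at h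
    simpa using h
  · ext1 z
    have h := hT.second_bianchi e u v z
    rw [hperpN u hu, hperpN v hv] at h
    simpa using h

lemma jacobi_selfAdjoint (hT : IsTwoSymmetricJet G T) (hG : ∀ u v, G u v = G v u) (v y z : V) :
    G (jacobi T v y) z = G y (jacobi T v z) := by
  rw [jacobi_apply, jacobi_apply, hT.pair_symm hG, hT.antisymm, map_neg, neg_apply, hT.skew,
    neg_neg, hG, hT.antisymm, map_neg, neg_apply, hG]

/-- The trace of the square of the Jacobi operator is the sixth power of a null covector. -/
lemma exists_null_trace (hT : IsTwoSymmetricJet G T) (hb : IsLorentzBasis G b i₀) (hT0 : T ≠ 0) :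
    ∃ κ : V, κ ≠ 0 ∧ G κ κ = 0 ∧
      ∀ v, LinearMap.trace ℝ V ((jacobi T v : V →ₗ[ℝ] V) * jacobi T v) = G κ v ^ 6 := by
  have : FiniteDimensional ℝ V := b.finiteDimensional_of_finite
  obtain ⟨k, hk, hkk, hTv, hTk, hTp⟩ := hT.exists_null hb hT0
  have h0 := hb.apply_timelike_ne_zero hk hkk
  obtain ⟨v₀, hv₀, hb₀⟩ : ∃ v₀, G k v₀ = 1 ∧ b i₀ = G k (b i₀) • v₀ :=
    ⟨(G k (b i₀))⁻¹ • b i₀, by simp [h0], by simp [h0]⟩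
  have hperp : ∀ v, G k (v - G k v • v₀) = 0 := fun v => by simp [hv₀]
  have hTe : ∀ v, T v = G k v • T v₀ := fun v => by
    have h := hTv _ (hperp v)
    rwa [map_sub, map_smul, sub_eq_zero] at h
  have hdiag : ∀ u v, T v₀ u u v = 0 := fun u v => by
    have := hT.antisymm v₀ u u v
    rw [eq_neg_iff_add_eq_zero, ← two_smul ℝ] at this
    simpa using this
  have hC : ∀ y v u, T v₀ y v u = G k v • T v₀ y v₀ u - G k y • T v₀ v v₀ u := fun y v u => by
    have h := congrArg (fun f => f u) (hTp v₀ _ _ (hperp y) (hperp v))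
    simp only [map_sub, map_smul, sub_apply, smul_apply, zero_apply, hdiag] at h
    rw [hT.antisymm v₀ v₀ v] at h
    rw [← sub_eq_zero, ← h]
    module
  have hJk : ∀ y, G k (jacobi T v₀ y) = 0 := fun y => by
    rw [hb.symm, jacobi_apply, hT.pair_symm hb.symm, hTk]; simp
  have hkJ : ∀ z, T v₀ k z = 0 := fun z => by
    ext1 u; rw [hT.antisymm, hTk]; simp
  have hCv : ∀ z v, T v₀ z v₀ v = G k v • jacobi T v₀ z + G (T v₀ z v₀ v) v₀ • k := fun z v => by
    rw [← sub_eq_zero]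
    refine hb.eq_zero fun u => ?_
    have h1 : G (jacobi T v₀ z) v₀ = 0 := by
      have := hT.skew v₀ z v₀ v₀ v₀
      rw [hb.symm v₀] at this
      rw [jacobi_apply]; linarith
    have h2 := hT.pair_symm hb.symm v₀ z v₀ (v - G k v • v₀) u
    have h3 : T v₀ (v - G k v • v₀) u = G k u • T v₀ (v - G k v • v₀) v₀ := by
      rw [← map_smul, ← sub_eq_zero, ← map_sub]; exact hTp _ _ _ (hperp v) (hperp u)
    rw [h3, smul_apply, map_smul, smul_apply,
      hT.pair_symm hb.symm v₀ (v - G k v • v₀) v₀ z v₀] at h2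
    simp only [map_sub, map_smul, sub_apply, smul_apply, map_add, add_apply, smul_eq_mul,
      ← jacobi_apply] at h2 ⊢
    rw [h1] at h2
    linear_combination h2
  set A : V →ₗ[ℝ] V := (jacobi T v₀ : V →ₗ[ℝ] V) with hA
  set c := LinearMap.trace ℝ V (A * A) with hc
  have hAb : A (b i₀) = 0 := by
    rw [hb₀, map_smul]
    simp [hA, hdiag]
  have hAs : ∀ u v, G (A u) v = G u (A v) := hT.jacobi_selfAdjoint hb.symm v₀
  have hc0 : 0 ≤ c := hb.trace_sq_nonneg A hAs hAb
  have hcpos : 0 < c := by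
    refine lt_of_le_of_ne hc0 fun h => hT0 ?_
    have hA0 : ∀ z, jacobi T v₀ z = 0 := fun z =>
      LinearMap.congr_fun (hb.eq_zero_of_trace_sq A hAs hAb h.symm) z
    have hz : ∀ z u, T v₀ z v₀ u = 0 := fun z u => by
      rw [hCv, hA0, hT.pair_symm hb.symm, hT.skew, ← jacobi_apply, hA0]; simp
    ext e y v u
    rw [hTe, smul_apply, smul_apply, smul_apply, hC, hz, hz]; simp
  have htr : ∀ v, LinearMap.trace ℝ V ((jacobi T v : V →ₗ[ℝ] V) * jacobi T v) =
      c * G k v ^ 6 := fun v => by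
    set a := G k v with ha
    let m : V →ₗ[ℝ] ℝ := ((G.flip v₀) ∘L (((T v₀).flip v₀).flip v) : V →L[ℝ] ℝ)
    let l : V →ₗ[ℝ] ℝ := a ^ 2 • m - (a * m v) • (G k : V →ₗ[ℝ] ℝ)
    have hm : ∀ z, m z = G (T v₀ z v₀ v) v₀ := fun _ => rfl
    have hl : ∀ y, l y = a ^ 2 * m y - a * m v * G k y := fun _ => rfl
    have hlk : l k = 0 := by rw [hl, hm, hkJ, hkk]; simp
    have hJ : ∀ y, jacobi T v y = a ^ 3 • A y - (a ^ 2 * G k y) • A v + l y • k := fun y => by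
      rw [jacobi_apply, hTe, smul_apply, smul_apply, smul_apply, hC, hCv y v, hCv v v, hl, hm, hm]
      simp only [hA, ContinuousLinearMap.coe_coe]
      module
    have hAk : A k = 0 := by simp [hA, hkJ]
    have hJk0 : jacobi T v k = 0 := by rw [hJ, hAk, hkk, hlk]; simp
    have hlJ : ∀ y, G k (jacobi T v y) = 0 := fun y => by
      rw [hJ]; simp only [map_add, map_sub, map_smul, hkk, hA, ContinuousLinearMap.coe_coe, hJk]
      simp
    have hJJ : (jacobi T v : V →ₗ[ℝ] V) * jacobi T v = a ^ 6 • (A * A) +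
        (G k : V →ₗ[ℝ] ℝ).smulRight (-a ^ 5 • A (A v)) +
        (l ∘ₗ (jacobi T v : V →ₗ[ℝ] V)).smulRight k := by
      ext y
      simp only [Module.End.mul_apply, ContinuousLinearMap.coe_coe, LinearMap.add_apply,
        LinearMap.smul_apply, LinearMap.smulRight_apply, LinearMap.comp_apply]
      rw [hJ (jacobi T v y), hlJ, hJ y]
      simp only [map_add, map_sub, map_smul, hAk]
      module
    rw [hJJ, map_add, map_add, map_smul, LinearMap.trace_smulRight, LinearMap.trace_smulRight]
    simp only [ContinuousLinearMap.coe_coe, LinearMap.comp_apply, map_smul, hJk0, hA, hJk]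
    simp only [hc, hA, smul_eq_mul, map_zero]
    ring
  have hr : (c ^ (1 / 6 : ℝ)) ^ 6 = c := by
    rw [← Real.rpow_natCast, ← Real.rpow_mul hc0]; norm_num
  refine ⟨c ^ (1 / 6 : ℝ) • k, smul_ne_zero (Real.rpow_pos_of_pos hcpos _).ne' hk, ?_, fun v => ?_⟩
  · simp [hkk]
  · rw [htr, map_smul, smul_apply, smul_eq_mul, mul_pow, hr]

end IsTwoSymmetricJet

end LorentzAlgebra

section SignLift

open Topology

variable {V : Type*} [NormedAddCommGroup V] [NormedSpace ℝ V]

/-- The action of `±1` on nonzero vectors. -/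
@[reducible] def signAction (V : Type*) [NormedAddCommGroup V] :
    MulAction ℤˣ {v : V // v ≠ 0} where
  smul ε v := ⟨ε • v.1, fun h => v.2 ((smul_eq_zero_iff_eq ε).1 h)⟩
  one_smul v := Subtype.ext (one_smul _ v.1)
  mul_smul a c v := Subtype.ext (mul_smul a c v.1)

attribute [local instance] signAction

lemma coe_sign_smul {V : Type*} [NormedAddCommGroup V] (ε : ℤˣ) (v : {v : V // v ≠ 0}) :
    ((ε • v : {v : V // v ≠ 0}) : V) = ε • v.1 :=
  rfl

lemma isQuotientCoveringMap_sign :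
    IsQuotientCoveringMap
      (Quotient.mk (MulAction.orbitRel ℤˣ {v : V // v ≠ 0})) ℤˣ where
  toIsQuotientMap := isQuotientMap_quot_mk
  continuous_const_smul ε := by
    refine Continuous.subtype_mk ?_ _
    rcases Int.units_eq_one_or ε with rfl | rfl
    · simpa using continuous_subtype_val
    · simpa using! continuous_subtype_val.neg
  apply_eq_iff_mem_orbit {a c} := by
    rw [Quotient.eq]; rfl
  disjoint e := by
    refine ⟨Subtype.val ⁻¹' Metric.ball e.1 ‖e.1‖, ?_, fun ε => ?_⟩
    · exact continuous_subtype_val.continuousAt.preimage_mem_nhds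
        (Metric.ball_mem_nhds _ (norm_pos_iff.2 e.2))
    rcases Int.units_eq_one_or ε with rfl | rfl
    · simp
    rintro ⟨_, ⟨y, hy, rfl⟩, hy'⟩
    exfalso
    simp only [Set.mem_preimage, Metric.mem_ball, dist_eq_norm, coe_sign_smul, Units.neg_smul,
      one_smul] at hy hy'
    have h := norm_add_le (y.1 - e.1) (-y.1 - e.1)
    rw [show (y.1 - e.1) + (-y.1 - e.1) = -((2 : ℝ) • e.1) by module, norm_neg, norm_smul,
      Real.norm_ofNat] at h
    linarith

/-- A line-field-like datum `±κ` on a simply connected, locally path connected space with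
continuous local choices of sign has a continuous global choice. -/
lemma exists_continuous_sign_choice {A : Type*} [TopologicalSpace A] [SimplyConnectedSpace A]
    [LocallyPathConnectedSpace A] (κ : A → V) (hκ : ∀ a, κ a ≠ 0)
    (hloc : ∀ a, ∃ σ : A → V, ContinuousAt σ a ∧ ∀ᶠ y in 𝓝 a, σ y = κ y ∨ σ y = -κ y) :
    ∃ s : A → V, Continuous s ∧ ∀ a, s a = κ a ∨ s a = -κ a := by
  let E : Type _ := {v : V // v ≠ 0}
  let p : E → Quotient (MulAction.orbitRel ℤˣ E) := Quotient.mk _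
  have hp : IsQuotientCoveringMap p ℤˣ := isQuotientCoveringMap_sign
  have key : ∀ u v : E, (u.1 = v.1 ∨ u.1 = -v.1) ↔ p u = p v := by
    intro u v
    rw [hp.apply_eq_iff_mem_orbit, MulAction.mem_orbit_iff]
    constructor
    · rintro (h | h)
      · exact ⟨1, Subtype.ext (by rw [coe_sign_smul, one_smul, h])⟩
      · exact ⟨-1, Subtype.ext (by rw [coe_sign_smul, Units.neg_smul, one_smul, h])⟩
    · rintro ⟨ε, rfl⟩
      rcases Int.units_eq_one_or ε with rfl | rfl
      · left; rw [one_smul]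
      · right; rw [coe_sign_smul, Units.neg_smul, one_smul]
  have hcont : Continuous fun a => p ⟨κ a, hκ a⟩ := by
    refine continuous_iff_continuousAt.2 fun a => ?_
    obtain ⟨σ, hσ, hσκ⟩ := hloc a
    classical
    let τ : A → E := fun y => if h : σ y = κ y ∨ σ y = -κ y then
      ⟨σ y, by rcases h with h | h <;> simp [h, hκ y]⟩ else ⟨κ y, hκ y⟩
    have hτ : ∀ᶠ y in 𝓝 a, (τ y).1 = σ y := hσκ.mono fun y hy => by simp [τ, hy]
    have hτc : ContinuousAt τ a := by
      refine Topology.IsInducing.subtypeVal.continuousAt_iff.2 ?_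
      exact hσ.congr (hτ.mono fun y hy => hy.symm)
    refine (hp.continuous.continuousAt.comp hτc).congr ?_
    filter_upwards [hτ, hσκ] with y hy hy'
    exact (key _ _).1 (by rw [hy]; exact hy')
  obtain ⟨a₀⟩ : Nonempty A := inferInstance
  obtain ⟨F, ⟨-, hF⟩, -⟩ := hp.isCoveringMap.existsUnique_continuousMap_lifts
    ⟨fun a => p ⟨κ a, hκ a⟩, hcont⟩ a₀ ⟨κ a₀, hκ a₀⟩ rfl
  exact ⟨fun a => (F a : E).1, continuous_subtype_val.comp F.continuous,
    fun a => (key _ ⟨κ a, hκ a⟩).2 (congrFun hF a)⟩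

end SignLift

section Curvature

open scoped ContDiff

set_option maxSynthPendingDepth 3

variable {V : Type*} [NormedAddCommGroup V] [NormedSpace ℝ V]

lemma fderiv_clm_apply_apply {E F : Type*} [NormedAddCommGroup E] [NormedSpace ℝ E]
    [NormedAddCommGroup F] [NormedSpace ℝ F] {c : V → E →L[ℝ] F} {u : V → E} {x : V}
    (hc : DifferentiableAt ℝ c x) (hu : DifferentiableAt ℝ u x) (w : V) :
    fderiv ℝ (fun y => c y (u y)) x w = fderiv ℝ c x w (u x) + c x (fderiv ℝ u x w) := by
  rw [(hc.hasFDerivAt.clm_apply hu.hasFDerivAt).fderiv]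
  simp [add_comm]

lemma fderiv_fun_add_apply {F : Type*} [NormedAddCommGroup F] [NormedSpace ℝ F] {f h : V → F}
    {x : V} (hf : DifferentiableAt ℝ f x) (hh : DifferentiableAt ℝ h x) (w : V) :
    fderiv ℝ (fun y => f y + h y) x w = fderiv ℝ f x w + fderiv ℝ h x w := by
  rw [fderiv_fun_add hf hh, add_apply]

lemma fderiv_fun_sub_apply {F : Type*} [NormedAddCommGroup F] [NormedSpace ℝ F] {f h : V → F}
    {x : V} (hf : DifferentiableAt ℝ f x) (hh : DifferentiableAt ℝ h x) (w : V) :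
    fderiv ℝ (fun y => f y - h y) x w = fderiv ℝ f x w - fderiv ℝ h x w := by
  rw [fderiv_fun_sub hf hh, sub_apply]

lemma fderiv_fun_neg_apply {F : Type*} [NormedAddCommGroup F] [NormedSpace ℝ F] {f : V → F}
    {x : V} (w : V) : fderiv ℝ (fun y => -f y) x w = -fderiv ℝ f x w := by
  rw [fderiv_fun_neg, neg_apply]

lemma fderiv_const_apply_apply {F : Type*} [NormedAddCommGroup F] [NormedSpace ℝ F] (c : F)
    (x w : V) : fderiv ℝ (fun _ : V => c) x w = 0 := by
  rw [fderiv_fun_const, Pi.zero_apply, zero_apply]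

lemma fderiv_fderiv_comm {F : Type*} [NormedAddCommGroup F] [NormedSpace ℝ F] {f : V → F}
    (hf : ContDiff ℝ ∞ f) (x v w : V) :
    fderiv ℝ (fderiv ℝ f) x v w = fderiv ℝ (fderiv ℝ f) x w v :=
  (hf.contDiffAt.isSymmSndFDerivAt (by
    rw [minSmoothness_of_isRCLikeNormedField]; exact WithTop.coe_le_coe.2 le_top)).eq v w

/-- The curvature operator of the connection `d + Γ`. -/
def curv (Γ : V → V →L[ℝ] V →L[ℝ] V) (x : V) : V →L[ℝ] V →L[ℝ] V →L[ℝ] V :=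
  fderiv ℝ Γ x - (fderiv ℝ Γ x).flip +
    ((ContinuousLinearMap.compL ℝ V V V).bilinearComp (Γ x) (Γ x) -
      ((ContinuousLinearMap.compL ℝ V V V).bilinearComp (Γ x) (Γ x)).flip)

lemma curv_apply (Γ : V → V →L[ℝ] V →L[ℝ] V) (x X Y Z : V) :
    curv Γ x X Y Z = fderiv ℝ Γ x X Y Z - fderiv ℝ Γ x Y X Z +
      (Γ x X (Γ x Y Z) - Γ x Y (Γ x X Z)) := by
  simp [curv]

/-- The action of an endomorphism on curvature operators, as a derivation. -/
def derivCurv (A : V →L[ℝ] V) (R : V →L[ℝ] V →L[ℝ] V →L[ℝ] V) : V →L[ℝ] V →L[ℝ] V →L[ℝ] V :=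
  (ContinuousLinearMap.compL ℝ V (V →L[ℝ] V) (V →L[ℝ] V)
    (ContinuousLinearMap.compL ℝ V V V A - (ContinuousLinearMap.compL ℝ V V V).flip A)).comp R -
    ((ContinuousLinearMap.compL ℝ V V (V →L[ℝ] V)).flip A).comp R - R.comp A

lemma derivCurv_apply (A : V →L[ℝ] V) (R : V →L[ℝ] V →L[ℝ] V →L[ℝ] V) (X Y Z : V) :
    derivCurv A R X Y Z = A (R X Y Z) - R X Y (A Z) - R X (A Y) Z - R (A X) Y Z := by
  simp [derivCurv]

/-- The covariant derivative of the curvature operator of the connection `d + Γ`. -/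
def covCurv [FiniteDimensional ℝ V] (Γ : V → V →L[ℝ] V →L[ℝ] V) (x : V) :
    V →L[ℝ] V →L[ℝ] V →L[ℝ] V →L[ℝ] V :=
  LinearMap.toContinuousLinearMap
    { toFun := fun E => fderiv ℝ (curv Γ) x E + derivCurv (Γ x E) (curv Γ x)
      map_add' := fun a c => by
        ext X Y Z; simp only [map_add, add_apply, derivCurv_apply]; abel
      map_smul' := fun a c => by
        ext X Y Z
        simp only [map_smul, add_apply, smul_apply, derivCurv_apply, smul_add, smul_sub,
          RingHom.id_apply] }

variable [FiniteDimensional ℝ V]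

lemma covCurv_apply (Γ : V → V →L[ℝ] V →L[ℝ] V) (x E X Y Z : V) :
    covCurv Γ x E X Y Z = fderiv ℝ (curv Γ) x E X Y Z + (Γ x E (curv Γ x X Y Z) -
      curv Γ x X Y (Γ x E Z) - curv Γ x X (Γ x E Y) Z - curv Γ x (Γ x E X) Y Z) := by
  simp [covCurv, derivCurv_apply]

/-- `Γ` is the Levi-Civita connection form of the metric field `G`. -/
structure IsLeviCivita (G : V → V →L[ℝ] V →L[ℝ] ℝ) (Γ : V → V →L[ℝ] V →L[ℝ] V) : Prop where
  contDiff_metric : ContDiff ℝ ∞ G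
  contDiff : ContDiff ℝ ∞ Γ
  metric_symm : ∀ x u v, G x u v = G x v u
  torsion_free : ∀ x u v, Γ x u v = Γ x v u
  compat : ∀ x w u v, fderiv ℝ G x w u v = G x (Γ x w u) v + G x u (Γ x w v)

lemma contDiff_curv {Γ : V → V →L[ℝ] V →L[ℝ] V} (hΓ : ContDiff ℝ ∞ Γ) :
    ContDiff ℝ ∞ (curv Γ) := by
  have h1 : ContDiff ℝ ∞ (fderiv ℝ Γ) := hΓ.fderiv_right (m := ∞) (by simp)
  simp only [contDiff_clm_apply_iff, curv_apply] at *
  intro X Y Z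
  have h2 : ∀ y, ContDiff ℝ ∞ fun x => Γ x y := fun y => contDiff_clm_apply_iff.2 (hΓ y)
  exact ((h1 X Y Z).sub (h1 Y X Z)).add (((h2 X).clm_apply (hΓ Y Z)).sub
    ((h2 Y).clm_apply (hΓ X Z)))

lemma contDiff_covCurv {Γ : V → V →L[ℝ] V →L[ℝ] V} (hΓ : ContDiff ℝ ∞ Γ) :
    ContDiff ℝ ∞ (covCurv Γ) := by
  have h0 := contDiff_curv hΓ
  have h1 : ContDiff ℝ ∞ (fderiv ℝ (curv Γ)) := h0.fderiv_right (m := ∞) (by simp)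
  simp only [contDiff_clm_apply_iff, covCurv_apply]
  intro E X Y Z
  fun_prop

end Curvature

section CurvatureSymmetries

open scoped ContDiff

set_option maxSynthPendingDepth 3

variable {V : Type*} [NormedAddCommGroup V] [NormedSpace ℝ V]

lemma curv_antisymm (Γ : V → V →L[ℝ] V →L[ℝ] V) (x X Y Z : V) :
    curv Γ x X Y Z = -curv Γ x Y X Z := by
  simp only [curv_apply]; abel

variable {G : V → V →L[ℝ] V →L[ℝ] ℝ} {Γ : V → V →L[ℝ] V →L[ℝ] V}

namespace IsLeviCivita

lemma differentiable (h : IsLeviCivita G Γ) : Differentiable ℝ Γ :=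
  h.contDiff.differentiable (by simp)

lemma differentiable_metric (h : IsLeviCivita G Γ) : Differentiable ℝ G :=
  h.contDiff_metric.differentiable (by simp)

lemma contDiff_fderiv (h : IsLeviCivita G Γ) : ContDiff ℝ ∞ (fderiv ℝ Γ) :=
  h.contDiff.fderiv_right (m := ∞) (by simp)

lemma differentiable_fderiv (h : IsLeviCivita G Γ) : Differentiable ℝ (fderiv ℝ Γ) :=
  h.contDiff_fderiv.differentiable (by simp)

lemma fderiv_torsion_free (h : IsLeviCivita G Γ) (x w u v : V) :
    fderiv ℝ Γ x w u v = fderiv ℝ Γ x w v u := by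
  have hΓ := h.differentiable
  have key : (fun y => Γ y u v) = fun y => Γ y v u := funext fun y => h.torsion_free y u v
  have := congrArg (fun f => fderiv ℝ f x w) key
  simpa (disch := fun_prop) only [fderiv_clm_apply_apply, fderiv_const_apply_apply, map_zero,
    add_zero] using this

lemma curv_bianchi (h : IsLeviCivita G Γ) (x X Y Z : V) :
    curv Γ x X Y Z + curv Γ x Y Z X + curv Γ x Z X Y = 0 := by
  simp only [curv_apply]
  rw [h.fderiv_torsion_free x X Y Z, h.fderiv_torsion_free x Y Z X, h.fderiv_torsion_free x Z X Y,
    h.torsion_free x Y Z, h.torsion_free x X Z, h.torsion_free x Y X]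
  abel

lemma curv_skew (h : IsLeviCivita G Γ) (x X Y u v : V) :
    G x (curv Γ x X Y u) v = -G x u (curv Γ x X Y v) := by
  have hΓ := h.differentiable
  have hG := h.differentiable_metric
  have hG' : Differentiable ℝ (fderiv ℝ G) :=
    (h.contDiff_metric.fderiv_right (m := ∞) (by simp)).differentiable (by simp)
  have key : ∀ X Y, fderiv ℝ (fderiv ℝ G) x X Y u v =
      G x (Γ x X (Γ x Y u)) v + G x (Γ x Y u) (Γ x X v) + G x (fderiv ℝ Γ x X Y u) v +
      (G x (Γ x X u) (Γ x Y v) + G x u (Γ x X (Γ x Y v)) + G x u (fderiv ℝ Γ x X Y v)) := by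
    intro X Y
    have e : (fun y => fderiv ℝ G y Y u v) = fun y => G y (Γ y Y u) v + G y u (Γ y Y v) :=
      funext fun y => h.compat y Y u v
    have := congrArg (fun f => fderiv ℝ f x X) e
    simp (disch := fun_prop) only [fderiv_fun_add_apply, fderiv_clm_apply_apply,
      fderiv_const_apply_apply, map_zero, add_zero, add_apply] at this
    rw [this, h.compat, h.compat]
  have h2 := congrArg (fun f => f u v) (fderiv_fderiv_comm h.contDiff_metric x X Y)
  simp only [key] at h2
  simp only [curv_apply, map_add, map_sub, add_apply, sub_apply]
  linarith

variable [FiniteDimensional ℝ V]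

lemma differentiable_curv (h : IsLeviCivita G Γ) : Differentiable ℝ (curv Γ) :=
  (contDiff_curv h.contDiff).differentiable (by simp)

lemma contDiff_fderiv_curv (h : IsLeviCivita G Γ) : ContDiff ℝ ∞ (fderiv ℝ (curv Γ)) :=
  (contDiff_curv h.contDiff).fderiv_right (m := ∞) (by simp)

lemma differentiable_fderiv_curv (h : IsLeviCivita G Γ) : Differentiable ℝ (fderiv ℝ (curv Γ)) :=
  h.contDiff_fderiv_curv.differentiable (by simp)

lemma differentiable_covCurv (h : IsLeviCivita G Γ) : Differentiable ℝ (covCurv Γ) :=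
  (contDiff_covCurv h.contDiff).differentiable (by simp)

lemma fderiv_curv_apply (h : IsLeviCivita G Γ) (x W X Y Z : V) :
    fderiv ℝ (curv Γ) x W X Y Z = fderiv ℝ (fderiv ℝ Γ) x W X Y Z -
      fderiv ℝ (fderiv ℝ Γ) x W Y X Z +
      (fderiv ℝ Γ x W X (Γ x Y Z) + Γ x X (fderiv ℝ Γ x W Y Z) -
       (fderiv ℝ Γ x W Y (Γ x X Z) + Γ x Y (fderiv ℝ Γ x W X Z))) := by
  have hΓ := h.differentiable
  have hΓ' := h.differentiable_fderiv
  have hR := h.differentiable_curv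
  have e : (fun y => curv Γ y X Y Z) = fun y => fderiv ℝ Γ y X Y Z - fderiv ℝ Γ y Y X Z +
      (Γ y X (Γ y Y Z) - Γ y Y (Γ y X Z)) := funext fun y => curv_apply Γ y X Y Z
  have := congrArg (fun f => fderiv ℝ f x W) e
  simpa (disch := fun_prop) only [fderiv_fun_add_apply, fderiv_fun_sub_apply,
    fderiv_clm_apply_apply, fderiv_const_apply_apply, map_zero, add_zero] using this

lemma covCurv_second_bianchi (h : IsLeviCivita G Γ) (x X Y Z W : V) :
    covCurv Γ x X Y Z W + covCurv Γ x Y Z X W + covCurv Γ x Z X Y W = 0 := by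
  simp only [covCurv_apply, h.fderiv_curv_apply]
  rw [fderiv_fderiv_comm h.contDiff x Y X, fderiv_fderiv_comm h.contDiff x Z X,
    fderiv_fderiv_comm h.contDiff x Z Y, h.torsion_free x Y X, h.torsion_free x Z X,
    h.torsion_free x Z Y, curv_antisymm Γ x Z (Γ x X Y), curv_antisymm Γ x Y (Γ x X Z),
    curv_antisymm Γ x X (Γ x Y Z)]
  simp only [curv_apply, map_add, map_sub]
  abel

lemma covCurv_antisymm (h : IsLeviCivita G Γ) (x E X Y Z : V) :
    covCurv Γ x E X Y Z = -covCurv Γ x E Y X Z := by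
  simp only [covCurv_apply, h.fderiv_curv_apply]
  rw [curv_antisymm Γ x Y X, curv_antisymm Γ x Y X, curv_antisymm Γ x Y (Γ x E X),
    curv_antisymm Γ x _ X, map_neg]
  abel

lemma covCurv_bianchi (h : IsLeviCivita G Γ) (x E X Y Z : V) :
    covCurv Γ x E X Y Z + covCurv Γ x E Y Z X + covCurv Γ x E Z X Y = 0 := by
  have hR := h.differentiable_curv
  have e : (fun y => curv Γ y X Y Z + curv Γ y Y Z X + curv Γ y Z X Y) = fun _ => 0 :=
    funext fun y => h.curv_bianchi y X Y Z
  have e1 := congrArg (fun f => fderiv ℝ f x E) e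
  simp (disch := fun_prop) only [fderiv_fun_add_apply,
    fderiv_clm_apply_apply, fderiv_const_apply_apply, map_zero, add_zero] at e1
  have e2 := congrArg (Γ x E) (h.curv_bianchi x X Y Z)
  simp only [map_add, map_zero] at e2
  have e3 := h.curv_bianchi x (Γ x E X) Y Z
  have e4 := h.curv_bianchi x X (Γ x E Y) Z
  have e5 := h.curv_bianchi x X Y (Γ x E Z)
  simp only [covCurv_apply]
  have := congrArg₂ (· - ·) (congrArg₂ (· + ·) e1 e2)
    (congrArg₂ (· + ·) e3 (congrArg₂ (· + ·) e4 e5))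
  simp only [add_zero, sub_zero] at this
  rw [← this]
  abel

lemma covCurv_skew (h : IsLeviCivita G Γ) (x E X Y u v : V) :
    G x (covCurv Γ x E X Y u) v = -G x u (covCurv Γ x E X Y v) := by
  have hR := h.differentiable_curv
  have hG := h.differentiable_metric
  have e : (fun y => G y (curv Γ y X Y u) v) = fun y => -G y u (curv Γ y X Y v) :=
    funext fun y => h.curv_skew y X Y u v
  have e1 := congrArg (fun f => fderiv ℝ f x E) e
  simp (disch := fun_prop) only [fderiv_fun_neg_apply, fderiv_clm_apply_apply,
    fderiv_const_apply_apply, map_zero, add_zero, h.compat, add_apply] at e1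
  have e2 := h.curv_skew x (Γ x E X) Y u v
  have e3 := h.curv_skew x X (Γ x E Y) u v
  have e4 := h.curv_skew x X Y (Γ x E u) v
  have e5 := h.curv_skew x X Y u (Γ x E v)
  simp only [covCurv_apply, map_add, map_sub, add_apply, sub_apply]
  linarith

end IsLeviCivita

end CurvatureSymmetries

section TwoSymmetry

open scoped ContDiff Topology

set_option maxSynthPendingDepth 3

variable {V : Type*} [NormedAddCommGroup V] [NormedSpace ℝ V] [FiniteDimensional ℝ V]
  {G : V → V →L[ℝ] V →L[ℝ] ℝ} {Γ : V → V →L[ℝ] V →L[ℝ] V} {D : Set V} {x : V}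

/-- The second covariant derivative of the curvature of `d + Γ` vanishes at `x`. -/
def IsTwoSymmetricAt (Γ : V → V →L[ℝ] V →L[ℝ] V) (x : V) : Prop :=
  ∀ W E X Y Z, fderiv ℝ (covCurv Γ) x W E X Y Z =
    covCurv Γ x (Γ x W E) X Y Z + covCurv Γ x E (Γ x W X) Y Z + covCurv Γ x E X (Γ x W Y) Z +
      covCurv Γ x E X Y (Γ x W Z) - Γ x W (covCurv Γ x E X Y Z)

namespace IsLeviCivita

lemma fderiv_curv_eq (Γ : V → V →L[ℝ] V →L[ℝ] V) (x E X Y Z : V) :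
    fderiv ℝ (curv Γ) x E X Y Z = covCurv Γ x E X Y Z + (curv Γ x X Y (Γ x E Z) +
      curv Γ x X (Γ x E Y) Z + curv Γ x (Γ x E X) Y Z - Γ x E (curv Γ x X Y Z)) := by
  rw [covCurv_apply]; abel

lemma fderiv_covCurv_apply (h : IsLeviCivita G Γ) (x W E X Y Z : V) :
    fderiv ℝ (covCurv Γ) x W E X Y Z = fderiv ℝ (fderiv ℝ (curv Γ)) x W E X Y Z +
      (fderiv ℝ Γ x W E (curv Γ x X Y Z) + Γ x E (fderiv ℝ (curv Γ) x W X Y Z) -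
      (fderiv ℝ (curv Γ) x W X Y (Γ x E Z) + curv Γ x X Y (fderiv ℝ Γ x W E Z)) -
      (fderiv ℝ (curv Γ) x W X (Γ x E Y) Z + curv Γ x X (fderiv ℝ Γ x W E Y) Z) -
      (fderiv ℝ (curv Γ) x W (Γ x E X) Y Z + curv Γ x (fderiv ℝ Γ x W E X) Y Z)) := by
  have hΓ := h.differentiable
  have hR := h.differentiable_curv
  have hR' := h.differentiable_fderiv_curv
  have hT := h.differentiable_covCurv
  have e : (fun y => covCurv Γ y E X Y Z) = fun y => fderiv ℝ (curv Γ) y E X Y Z +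
      (Γ y E (curv Γ y X Y Z) - curv Γ y X Y (Γ y E Z) - curv Γ y X (Γ y E Y) Z -
        curv Γ y (Γ y E X) Y Z) := funext fun y => covCurv_apply Γ y E X Y Z
  have := congrArg (fun f => fderiv ℝ f x W) e
  simpa (disch := fun_prop) only [fderiv_fun_add_apply, fderiv_fun_sub_apply,
    fderiv_clm_apply_apply, fderiv_const_apply_apply, map_zero, add_zero, add_apply] using this

/-- The Ricci identity for the curvature of a 2-symmetric connection. -/
lemma curv_curv (h : IsLeviCivita G Γ) (h2 : IsTwoSymmetricAt Γ x) (W E X Y Z : V) :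
    curv Γ x W E (curv Γ x X Y Z) = curv Γ x (curv Γ x W E X) Y Z +
      curv Γ x X (curv Γ x W E Y) Z + curv Γ x X Y (curv Γ x W E Z) := by
  have h1 := h2 W E X Y Z
  have h3 := h2 E W X Y Z
  rw [h.fderiv_covCurv_apply, ← sub_eq_zero] at h1 h3
  have key := h1.trans h3.symm
  rw [h.torsion_free x E W, fderiv_fderiv_comm (contDiff_curv h.contDiff) x E W,
    ← sub_eq_zero] at key
  rw [← sub_eq_zero, ← key]
  simp only [curv_apply Γ x W E, fderiv_curv_eq, map_add, map_sub, add_apply,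
    sub_apply]
  abel

set_option maxHeartbeats 2000000 in
/-- The Ricci identity for the derivative of the curvature of a 2-symmetric connection. -/
lemma curv_covCurv (h : IsLeviCivita G Γ) (h2 : ∀ᶠ y in 𝓝 x, IsTwoSymmetricAt Γ y)
    (W U E X Y Z : V) :
    curv Γ x W U (covCurv Γ x E X Y Z) = covCurv Γ x (curv Γ x W U E) X Y Z +
      covCurv Γ x E (curv Γ x W U X) Y Z + covCurv Γ x E X (curv Γ x W U Y) Z +
      covCurv Γ x E X Y (curv Γ x W U Z) := by
  have hΓ := h.differentiable
  have hT := h.differentiable_covCurv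
  have hT' : Differentiable ℝ (fderiv ℝ (covCurv Γ)) :=
    ((contDiff_covCurv h.contDiff).fderiv_right (m := ∞) (by simp)).differentiable (by simp)
  have h0 := h2.self_of_nhds
  have key : ∀ W U, fderiv ℝ (fderiv ℝ (covCurv Γ)) x W U E X Y Z =
      fderiv ℝ (covCurv Γ) x W (Γ x U E) X Y Z + covCurv Γ x (fderiv ℝ Γ x W U E) X Y Z +
      (fderiv ℝ (covCurv Γ) x W E (Γ x U X) Y Z + covCurv Γ x E (fderiv ℝ Γ x W U X) Y Z) +
      (fderiv ℝ (covCurv Γ) x W E X (Γ x U Y) Z + covCurv Γ x E X (fderiv ℝ Γ x W U Y) Z) +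
      (fderiv ℝ (covCurv Γ) x W E X Y (Γ x U Z) + covCurv Γ x E X Y (fderiv ℝ Γ x W U Z)) -
      (fderiv ℝ Γ x W U (covCurv Γ x E X Y Z) + Γ x U (fderiv ℝ (covCurv Γ) x W E X Y Z)) := by
    intro W U
    have e : (fun y => fderiv ℝ (covCurv Γ) y U E X Y Z) =ᶠ[𝓝 x] fun y =>
        covCurv Γ y (Γ y U E) X Y Z + covCurv Γ y E (Γ y U X) Y Z +
        covCurv Γ y E X (Γ y U Y) Z + covCurv Γ y E X Y (Γ y U Z) -
        Γ y U (covCurv Γ y E X Y Z) := h2.mono fun y hy => hy U E X Y Z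
    have := congrArg (fun f : V →L[ℝ] V => f W) e.fderiv_eq
    simpa (disch := fun_prop) only [fderiv_fun_add_apply, fderiv_fun_sub_apply,
      fderiv_clm_apply_apply, fderiv_const_apply_apply, map_zero, add_zero, add_apply] using this
  have h3 := congrArg (fun f => f E X Y Z)
    (fderiv_fderiv_comm (contDiff_covCurv h.contDiff) x W U)
  simp only [key, h0 _ _ _ _ _] at h3
  rw [← sub_eq_zero] at h3
  rw [← sub_eq_zero, ← neg_eq_zero, ← h3]
  simp only [curv_apply Γ x W U, map_add, map_sub, add_apply, sub_apply]
  abel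

lemma covCurv_curv (h : IsLeviCivita G Γ) (h2 : ∀ᶠ y in 𝓝 x, IsTwoSymmetricAt Γ y)
    (v W E X Y Z : V) :
    covCurv Γ x v W E (curv Γ x X Y Z) + curv Γ x W E (covCurv Γ x v X Y Z) =
      covCurv Γ x v (curv Γ x W E X) Y Z + curv Γ x (covCurv Γ x v W E X) Y Z +
      (covCurv Γ x v X (curv Γ x W E Y) Z + curv Γ x X (covCurv Γ x v W E Y) Z) +
      (covCurv Γ x v X Y (curv Γ x W E Z) + curv Γ x X Y (covCurv Γ x v W E Z)) := by
  have hR := h.differentiable_curv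
  have h0 := h2.self_of_nhds
  have e : (fun y => curv Γ y W E (curv Γ y X Y Z)) =ᶠ[𝓝 x] fun y =>
      curv Γ y (curv Γ y W E X) Y Z + curv Γ y X (curv Γ y W E Y) Z +
      curv Γ y X Y (curv Γ y W E Z) := h2.mono fun y hy => h.curv_curv hy W E X Y Z
  have := congrArg (fun f : V →L[ℝ] V => f v) e.fderiv_eq
  simp (disch := fun_prop) only [fderiv_fun_add_apply, fderiv_clm_apply_apply,
    fderiv_const_apply_apply, map_zero, add_zero, add_apply, fderiv_curv_eq, map_add, map_sub,
    sub_apply] at this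
  have k0 := congrArg (Γ x v) (h.curv_curv h0 W E X Y Z)
  simp only [map_add] at k0
  have k1 := h.curv_curv h0 (Γ x v W) E X Y Z
  have k2 := h.curv_curv h0 W (Γ x v E) X Y Z
  have k3 := h.curv_curv h0 W E (Γ x v X) Y Z
  have k4 := h.curv_curv h0 W E X (Γ x v Y) Z
  have k5 := h.curv_curv h0 W E X Y (Γ x v Z)
  rw [← sub_eq_zero] at this k0 k1 k2 k3 k4 k5 ⊢
  have k := congrArg₂ (· - ·) (congrArg₂ (· + ·) this k0)
    (congrArg₂ (· + ·) (congrArg₂ (· + ·) k1 k2)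
    (congrArg₂ (· + ·) (congrArg₂ (· + ·) k3 k4) k5))
  simp only [add_zero, sub_zero] at k
  rw [← k]
  abel

lemma covCurv_covCurv (h : IsLeviCivita G Γ) (h2 : ∀ᶠ y in 𝓝 x, IsTwoSymmetricAt Γ y)
    (v w A E X Y Z : V) :
    covCurv Γ x v A E (covCurv Γ x w X Y Z) + covCurv Γ x w A E (covCurv Γ x v X Y Z) =
      covCurv Γ x v (covCurv Γ x w A E X) Y Z + covCurv Γ x w (covCurv Γ x v A E X) Y Z +
      (covCurv Γ x v X (covCurv Γ x w A E Y) Z + covCurv Γ x w X (covCurv Γ x v A E Y) Z) +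
      (covCurv Γ x v X Y (covCurv Γ x w A E Z) + covCurv Γ x w X Y (covCurv Γ x v A E Z)) := by
  have hR := h.differentiable_curv
  have hT := h.differentiable_covCurv
  have h0 := h2.self_of_nhds
  have e := (eventually_eventually_nhds.2 h2).mono fun y hy => h.covCurv_curv hy v A E X Y Z
  have := congrArg (fun f : V →L[ℝ] V => f w) (Filter.EventuallyEq.fderiv_eq e)
  simp (disch := fun_prop) only [fderiv_fun_add_apply, fderiv_clm_apply_apply,
    fderiv_const_apply_apply, map_zero, add_zero, add_apply, fderiv_curv_eq, map_add, map_sub,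
    sub_apply, h0 _ _ _ _ _] at this
  have k0 := congrArg (Γ x w) (h.covCurv_curv h2 v A E X Y Z)
  simp only [map_add] at k0
  have k1 := h.covCurv_curv h2 v (Γ x w A) E X Y Z
  have k2 := h.covCurv_curv h2 v A (Γ x w E) X Y Z
  have k3 := h.covCurv_curv h2 v A E (Γ x w X) Y Z
  have k4 := h.covCurv_curv h2 v A E X (Γ x w Y) Z
  have k5 := h.covCurv_curv h2 v A E X Y (Γ x w Z)
  have k6 := h.covCurv_curv h2 (Γ x w v) A E X Y Z
  rw [← sub_eq_zero] at this k0 k1 k2 k3 k4 k5 k6 ⊢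
  have k := congrArg₂ (· - ·) (congrArg₂ (· + ·) this k0) (congrArg₂ (· + ·) (congrArg₂ (· + ·) k1
    (congrArg₂ (· + ·) k2 k6)) (congrArg₂ (· + ·) (congrArg₂ (· + ·) k3 k4) k5))
  simp only [add_zero, sub_zero] at k
  rw [← k]
  abel

lemma covCurv_covCurv_index (h : IsLeviCivita G Γ) (h2 : ∀ᶠ y in 𝓝 x, IsTwoSymmetricAt Γ y)
    (v W U E X Y Z : V) :
    covCurv Γ x v W U (covCurv Γ x E X Y Z) = covCurv Γ x (covCurv Γ x v W U E) X Y Z +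
      covCurv Γ x E (covCurv Γ x v W U X) Y Z + covCurv Γ x E X (covCurv Γ x v W U Y) Z +
      covCurv Γ x E X Y (covCurv Γ x v W U Z) := by
  have hR := h.differentiable_curv
  have hT := h.differentiable_covCurv
  have h0 := h2.self_of_nhds
  have e := (eventually_eventually_nhds.2 h2).mono fun y hy => h.curv_covCurv hy W U E X Y Z
  have := congrArg (fun f : V →L[ℝ] V => f v) (Filter.EventuallyEq.fderiv_eq e)
  simp (disch := fun_prop) only [fderiv_fun_add_apply, fderiv_clm_apply_apply,
    fderiv_const_apply_apply, map_zero, add_zero, add_apply, fderiv_curv_eq, map_add, map_sub,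
    sub_apply, h0 _ _ _ _ _] at this
  have k0 := congrArg (Γ x v) (h.curv_covCurv h2 W U E X Y Z)
  simp only [map_add] at k0
  have k1 := h.curv_covCurv h2 (Γ x v W) U E X Y Z
  have k2 := h.curv_covCurv h2 W (Γ x v U) E X Y Z
  have k3 := h.curv_covCurv h2 W U (Γ x v E) X Y Z
  have k4 := h.curv_covCurv h2 W U E (Γ x v X) Y Z
  have k5 := h.curv_covCurv h2 W U E X (Γ x v Y) Z
  have k6 := h.curv_covCurv h2 W U E X Y (Γ x v Z)
  rw [← sub_eq_zero] at this k0 k1 k2 k3 k4 k5 k6 ⊢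
  have k := congrArg₂ (· - ·) (congrArg₂ (· + ·) this k0) (congrArg₂ (· + ·) (congrArg₂ (· + ·) k1
    (congrArg₂ (· + ·) k2 k6)) (congrArg₂ (· + ·) (congrArg₂ (· + ·) k3 k4) k5))
  simp only [add_zero, sub_zero] at k
  rw [← k]
  abel

lemma isTwoSymmetricJet (h : IsLeviCivita G Γ) (h2 : ∀ᶠ y in 𝓝 x, IsTwoSymmetricAt Γ y) :
    IsTwoSymmetricJet (G x) (covCurv Γ x) where
  antisymm := h.covCurv_antisymm x
  skew e x' y z w := h.covCurv_skew x e x' y z w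
  bianchi := h.covCurv_bianchi x
  second_bianchi e x' y z := h.covCurv_second_bianchi x e x' y z
  null_index v w A E X Y Z := by
    have k1 := h.covCurv_covCurv h2 v w A E X Y Z
    have k2 := h.covCurv_covCurv_index h2 v A E w X Y Z
    have k3 := h.covCurv_covCurv_index h2 w A E v X Y Z
    rw [k2, k3, ← sub_eq_zero] at k1
    rw [← k1]
    abel

end IsLeviCivita

lemma norm_apply_four_le {E : Type*} [NormedAddCommGroup E] [NormedSpace ℝ E]
    (T : E →L[ℝ] E →L[ℝ] E →L[ℝ] E →L[ℝ] E) (a c d e : E) :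
    ‖T a c d e‖ ≤ ‖T‖ * ‖a‖ * ‖c‖ * ‖d‖ * ‖e‖ := by
  refine (ContinuousLinearMap.le_opNorm _ _).trans (mul_le_mul_of_nonneg_right ?_ (norm_nonneg _))
  refine (ContinuousLinearMap.le_opNorm _ _).trans (mul_le_mul_of_nonneg_right ?_ (norm_nonneg _))
  refine (ContinuousLinearMap.le_opNorm _ _).trans (mul_le_mul_of_nonneg_right ?_ (norm_nonneg _))
  exact ContinuousLinearMap.le_opNorm _ _

namespace IsTwoSymmetricAt

lemma norm_fderiv_le (h : IsTwoSymmetricAt Γ x) (W : V) :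
    ‖fderiv ℝ (covCurv Γ) x W‖ ≤ 5 * ‖Γ x W‖ * ‖covCurv Γ x‖ := by
  have hc : 0 ≤ 5 * ‖Γ x W‖ * ‖covCurv Γ x‖ := by positivity
  refine ContinuousLinearMap.opNorm_le_bound _ hc fun E => ?_
  refine ContinuousLinearMap.opNorm_le_bound _ (by positivity) fun X => ?_
  refine ContinuousLinearMap.opNorm_le_bound _ (by positivity) fun Y => ?_
  refine ContinuousLinearMap.opNorm_le_bound _ (by positivity) fun Z => ?_
  rw [h]
  have hA : ∀ v, ‖Γ x W v‖ ≤ ‖Γ x W‖ * ‖v‖ := fun v => ContinuousLinearMap.le_opNorm _ _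
  have k : ∀ a c d e, ‖covCurv Γ x a c d e‖ ≤ ‖covCurv Γ x‖ * ‖a‖ * ‖c‖ * ‖d‖ * ‖e‖ :=
    norm_apply_four_le _
  have k1 : ‖covCurv Γ x (Γ x W E) X Y Z‖ ≤ ‖Γ x W‖ * ‖covCurv Γ x‖ * ‖E‖ * ‖X‖ * ‖Y‖ * ‖Z‖ := by
    calc _ ≤ _ := k _ _ _ _
      _ ≤ ‖covCurv Γ x‖ * (‖Γ x W‖ * ‖E‖) * ‖X‖ * ‖Y‖ * ‖Z‖ := by gcongr; exact hA _
      _ = _ := by ring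
  have k2 : ‖covCurv Γ x E (Γ x W X) Y Z‖ ≤ ‖Γ x W‖ * ‖covCurv Γ x‖ * ‖E‖ * ‖X‖ * ‖Y‖ * ‖Z‖ := by
    calc _ ≤ _ := k _ _ _ _
      _ ≤ ‖covCurv Γ x‖ * ‖E‖ * (‖Γ x W‖ * ‖X‖) * ‖Y‖ * ‖Z‖ := by gcongr; exact hA _
      _ = _ := by ring
  have k3 : ‖covCurv Γ x E X (Γ x W Y) Z‖ ≤ ‖Γ x W‖ * ‖covCurv Γ x‖ * ‖E‖ * ‖X‖ * ‖Y‖ * ‖Z‖ := by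
    calc _ ≤ _ := k _ _ _ _
      _ ≤ ‖covCurv Γ x‖ * ‖E‖ * ‖X‖ * (‖Γ x W‖ * ‖Y‖) * ‖Z‖ := by gcongr; exact hA _
      _ = _ := by ring
  have k4 : ‖covCurv Γ x E X Y (Γ x W Z)‖ ≤ ‖Γ x W‖ * ‖covCurv Γ x‖ * ‖E‖ * ‖X‖ * ‖Y‖ * ‖Z‖ := by
    calc _ ≤ _ := k _ _ _ _
      _ ≤ ‖covCurv Γ x‖ * ‖E‖ * ‖X‖ * ‖Y‖ * (‖Γ x W‖ * ‖Z‖) := by gcongr; exact hA _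
      _ = _ := by ring
  have k5 : ‖Γ x W (covCurv Γ x E X Y Z)‖ ≤ ‖Γ x W‖ * ‖covCurv Γ x‖ * ‖E‖ * ‖X‖ * ‖Y‖ * ‖Z‖ := by
    calc _ ≤ _ := hA _
      _ ≤ ‖Γ x W‖ * (‖covCurv Γ x‖ * ‖E‖ * ‖X‖ * ‖Y‖ * ‖Z‖) := by gcongr; exact k _ _ _ _
      _ = _ := by ring
  refine (norm_sub_le _ _).trans ?_
  have s1 := norm_add_le (covCurv Γ x (Γ x W E) X Y Z + covCurv Γ x E (Γ x W X) Y Z +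
    covCurv Γ x E X (Γ x W Y) Z) (covCurv Γ x E X Y (Γ x W Z))
  have s2 := norm_add₃_le (a := covCurv Γ x (Γ x W E) X Y Z) (b := covCurv Γ x E (Γ x W X) Y Z)
    (c := covCurv Γ x E X (Γ x W Y) Z)
  linarith

lemma covCurv_eq_zero_of_segment (h : IsLeviCivita G Γ) {a c : V}
    (h2 : ∀ y ∈ segment ℝ a c, IsTwoSymmetricAt Γ y) (ha : covCurv Γ a = 0) :
    covCurv Γ c = 0 := by
  have hT := h.differentiable_covCurv
  have hΓ := h.differentiable
  let γ : ℝ → V := fun t => a + t • (c - a)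
  have hγ : ∀ t, HasDerivAt γ (c - a) t := fun t => by
    have := ((hasDerivAt_id t).smul_const (c - a)).const_add a
    rwa [one_smul] at this
  have hγc : Continuous γ := by fun_prop
  have hφ : ∀ t, HasDerivAt (fun t => covCurv Γ (γ t)) (fderiv ℝ (covCurv Γ) (γ t) (c - a)) t :=
    fun t => HasFDerivAt.comp_hasDerivAt (l := covCurv Γ) t (hT (γ t)).hasFDerivAt (hγ t)
  have hcont : Continuous fun t => 5 * ‖Γ (γ t) (c - a)‖ := by
    have := hΓ.continuous
    fun_prop
  obtain ⟨K, hK⟩ := (isCompact_Icc (a := (0 : ℝ)) (b := 1)).bddAbove_image hcont.continuousOn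
  have key := norm_le_gronwallBound_of_norm_deriv_right_le
    (f := fun t => covCurv Γ (γ t)) (f' := fun t => fderiv ℝ (covCurv Γ) (γ t) (c - a))
    (δ := 0) (K := K) (ε := 0) (a := 0) (b := 1)
    (fun t _ => (hφ t).continuousAt.continuousWithinAt) (fun t _ => (hφ t).hasDerivWithinAt)
    (by simp only [γ, zero_smul, add_zero, ha]; exact ContinuousLinearMap.opNorm_zero.le)
    (fun t ht => by
      have hmem : γ t ∈ segment ℝ a c := by
        rw [segment_eq_image']
        exact ⟨t, ⟨ht.1, ht.2.le⟩, rfl⟩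
      rw [add_zero]
      refine ((h2 _ hmem).norm_fderiv_le _).trans (mul_le_mul_of_nonneg_right ?_
        (ContinuousLinearMap.opNorm_nonneg _))
      exact hK ⟨t, ⟨ht.1, ht.2.le⟩, rfl⟩) 1 (by simp)
  simp only [γ, gronwallBound_ε0_δ0, one_smul, add_sub_cancel] at key
  exact (ContinuousLinearMap.opNorm_zero_iff _).1
    (key.antisymm (ContinuousLinearMap.opNorm_nonneg _))

/-- On a connected open set, the parallel tensor `∇R` vanishes identically or nowhere. -/
lemma covCurv_eq_zero (h : IsLeviCivita G Γ) (hD : IsOpen D) (hDc : IsPreconnected D)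
    (h2 : ∀ y ∈ D, IsTwoSymmetricAt Γ y) {a c : V} (haD : a ∈ D) (hcD : c ∈ D)
    (ha : covCurv Γ a = 0) : covCurv Γ c = 0 := by
  have hT := h.differentiable_covCurv.continuous
  by_contra hc
  have hopen : IsOpen {y ∈ D | covCurv Γ y = 0} := by
    refine isOpen_iff_mem_nhds.2 fun y hy => ?_
    obtain ⟨r, hr, hball⟩ := Metric.isOpen_iff.1 hD y hy.1
    refine Filter.mem_of_superset (Metric.ball_mem_nhds y hr) fun z hz => ⟨hball hz, ?_⟩
    exact covCurv_eq_zero_of_segment h (fun w hw => h2 w (hball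
      ((convex_ball y r).segment_subset (Metric.mem_ball_self hr) hz hw))) hy.2
  obtain ⟨z, -, hz1, hz2⟩ := hDc _ {y | covCurv Γ y ≠ 0} hopen
    (isOpen_ne_fun hT continuous_const) (fun y hy => by
      by_cases hy0 : covCurv Γ y = 0
      · exact Or.inl ⟨hy, hy0⟩
      · exact Or.inr hy0) ⟨a, haD, haD, ha⟩ ⟨c, hcD, hc⟩
  exact hz2 hz1.2

end IsTwoSymmetricAt

end TwoSymmetry

section ParallelNull

open scoped ContDiff Topology
open Module

set_option maxSynthPendingDepth 3

variable {V : Type*} [NormedAddCommGroup V] [NormedSpace ℝ V]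

lemma fderiv_fun_id_apply (x w : V) : fderiv ℝ (fun y : V => y) x w = w := by
  rw [fderiv_fun_id]; rfl

lemma eq_or_eq_neg_of_apply_pow_six {G : V →L[ℝ] V →L[ℝ] ℝ} (hG : ∀ v, (∀ w, G v w = 0) → v = 0)
    {κ σ v₀ : V} {r : ℝ} (hr : r ≠ 0) (hr6 : r ^ 6 = G κ v₀ ^ 6)
    (hσ : ∀ u, G σ u = G κ v₀ ^ 5 * G κ u / r ^ 5) : σ = κ ∨ σ = -κ := by
  have h0 : r ^ 2 = G κ v₀ ^ 2 := by
    have : (r ^ 2) ^ 3 = (G κ v₀ ^ 2) ^ 3 := by linear_combination hr6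
    exact (pow_left_inj₀ (sq_nonneg _) (sq_nonneg _) (by norm_num)).1 this
  rcases sq_eq_sq_iff_eq_or_eq_neg.1 h0 with h | h
  · left
    refine sub_eq_zero.1 (hG _ fun w => ?_)
    rw [map_sub, sub_apply, hσ, ← h]
    field_simp; simp
  · right
    refine add_eq_zero_iff_eq_neg.1 (hG _ fun w => ?_)
    rw [map_add, add_apply, hσ,
      eq_neg_iff_add_eq_zero.2 ((add_comm _ _).trans (eq_neg_iff_add_eq_zero.1 h))]
    field_simp; simp

variable [FiniteDimensional ℝ V]

lemma contDiff_jacobi (T : V →L[ℝ] V →L[ℝ] V →L[ℝ] V →L[ℝ] V) : ContDiff ℝ ∞ (jacobi T) := by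
  refine contDiff_clm_apply_iff.2 fun y => ?_
  simp only [jacobi_apply]
  fun_prop

lemma fderiv_jacobi_apply (T : V →L[ℝ] V →L[ℝ] V →L[ℝ] V →L[ℝ] V) (v u y : V) :
    fderiv ℝ (jacobi T) v u y = T u y v v + T v y u v + T v y v u := by
  have hJ : Differentiable ℝ (jacobi T) := (contDiff_jacobi T).differentiable (by simp)
  have e : (fun v => jacobi T v y) = fun v => T v y v v := funext fun v => jacobi_apply T v y
  have := congrArg (fun f => fderiv ℝ f v u) e
  simp (disch := fun_prop) only [fderiv_clm_apply_apply, fderiv_const_apply_apply, map_zero,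
    add_zero, add_apply, fderiv_fun_id_apply, ContinuousLinearMap.fderiv] at this
  exact this

/-- The trace as a continuous linear form. -/
def traceL (V : Type*) [NormedAddCommGroup V] [NormedSpace ℝ V] [FiniteDimensional ℝ V] :
    (V →L[ℝ] V) →L[ℝ] ℝ :=
  LinearMap.toContinuousLinearMap
    (LinearMap.trace ℝ V ∘ₗ ContinuousLinearMap.coeLM ℝ)

lemma traceL_comp (A B : V →L[ℝ] V) :
    traceL V (A ∘L B) = LinearMap.trace ℝ V ((A : V →ₗ[ℝ] V) * B) := rfl

lemma traceL_comp_comm (A B : V →L[ℝ] V) : traceL V (A ∘L B) = traceL V (B ∘L A) := by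
  rw [traceL_comp, traceL_comp, LinearMap.trace_mul_comm]

lemma fderiv_traceL_sq {E : Type*} [NormedAddCommGroup E] [NormedSpace ℝ E] {J : E → V →L[ℝ] V}
    {x : E} (hJ : DifferentiableAt ℝ J x) (w : E) :
    fderiv ℝ (fun y => traceL V (J y ∘L J y)) x w = 2 * traceL V (J x ∘L fderiv ℝ J x w) := by
  have h1 := (traceL V).hasFDerivAt.comp x (hJ.hasFDerivAt.clm_comp hJ.hasFDerivAt)
  have h2 : HasFDerivAt (fun y => traceL V (J y ∘L J y)) _ x := h1
  rw [h2.fderiv]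
  simp [traceL_comp_comm (fderiv ℝ J x w)]
  ring

lemma traceL_jacobi_fderiv {G : V →L[ℝ] V →L[ℝ] ℝ} {T : V →L[ℝ] V →L[ℝ] V →L[ℝ] V →L[ℝ] V}
    {κ : V} (h : ∀ v, traceL V (jacobi T v ∘L jacobi T v) = G κ v ^ 6) (v u : V) :
    traceL V (jacobi T v ∘L fderiv ℝ (jacobi T) v u) = 3 * G κ v ^ 5 * G κ u := by
  have hJ : Differentiable ℝ (jacobi T) := (contDiff_jacobi T).differentiable (by simp)
  have h1 := fderiv_traceL_sq (hJ v) u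
  have h2 : HasFDerivAt (fun v => G κ v ^ 6) _ v := (G κ).hasFDerivAt.pow 6
  rw [funext h, h2.fderiv] at h1
  simp at h1
  linarith

variable {G : V → V →L[ℝ] V →L[ℝ] ℝ} {Γ : V → V →L[ℝ] V →L[ℝ] V} {x : V}

lemma IsTwoSymmetricAt.fderiv_traceL_jacobi (h : IsLeviCivita G Γ) (h2 : IsTwoSymmetricAt Γ x)
    (v Z : V) :
    fderiv ℝ (fun y => traceL V (jacobi (covCurv Γ y) v ∘L jacobi (covCurv Γ y) v)) x Z =
      2 * traceL V (jacobi (covCurv Γ x) v ∘L fderiv ℝ (jacobi (covCurv Γ x)) v (Γ x Z v)) := by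
  have hT := h.differentiable_covCurv
  have hJ : ContDiff ℝ ∞ fun y => jacobi (covCurv Γ y) v := by
    refine contDiff_clm_apply_iff.2 fun y => ?_
    have := contDiff_covCurv h.contDiff
    simp only [jacobi_apply]
    fun_prop
  have hJd := hJ.differentiable (by simp)
  have e : fderiv ℝ (fun y => jacobi (covCurv Γ y) v) x Z =
      fderiv ℝ (jacobi (covCurv Γ x)) v (Γ x Z v) + jacobi (covCurv Γ x) v ∘L Γ x Z -
        Γ x Z ∘L jacobi (covCurv Γ x) v := by
    ext y
    have e1 : (fun z => jacobi (covCurv Γ z) v y) = fun z => covCurv Γ z v y v v :=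
      funext fun z => jacobi_apply _ v y
    have := congrArg (fun f => fderiv ℝ f x Z) e1
    simp (disch := fun_prop) only [fderiv_clm_apply_apply, fderiv_const_apply_apply, map_zero,
      add_zero] at this
    have e2 := fderiv_clm_apply_apply (hJd x) (differentiableAt_const y) Z
    rw [fderiv_const_apply_apply, map_zero, add_zero, this] at e2
    rw [← e2, h2, sub_apply, add_apply, fderiv_jacobi_apply]
    simp only [ContinuousLinearMap.comp_apply, jacobi_apply]
    abel
  rw [fderiv_traceL_sq (hJd x), e, ContinuousLinearMap.comp_sub, ContinuousLinearMap.comp_add,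
    map_sub, map_add, ← ContinuousLinearMap.comp_assoc _ (Γ x Z),
    traceL_comp_comm _ (jacobi (covCurv Γ x) v),
    ← ContinuousLinearMap.comp_assoc]
  ring

/-- Local smooth choice of sign for the null vector determined by `∇R`. -/
lemma IsLeviCivita.exists_local_sign_choice (h : IsLeviCivita G Γ)
    (hG : ∀ x v, (∀ w, G x v w = 0) → v = 0) {D : Set V} (hD : IsOpen D) {κ : V → V}
    (hκ : ∀ x ∈ D, ∀ v, traceL V (jacobi (covCurv Γ x) v ∘L jacobi (covCurv Γ x) v) =
      G x (κ x) v ^ 6) (hx : x ∈ D) (hκ0 : κ x ≠ 0) :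
    ∃ σ : V → V, DifferentiableAt ℝ σ x ∧ ∀ᶠ y in 𝓝 x, σ y = κ y ∨ σ y = -κ y := by
  obtain ⟨v₀, hv₀⟩ : ∃ v₀, G x (κ x) v₀ ≠ 0 := by
    by_contra! hc
    exact hκ0 (hG x _ hc)
  have hT := contDiff_covCurv h.contDiff
  have hJ : ContDiff ℝ ∞ fun y => jacobi (covCurv Γ y) v₀ := by
    refine contDiff_clm_apply_iff.2 fun y => ?_
    simp only [jacobi_apply]
    fun_prop
  have hJ' : ContDiff ℝ ∞ fun y => fderiv ℝ (jacobi (covCurv Γ y)) v₀ := by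
    refine contDiff_clm_apply_iff.2 fun u => contDiff_clm_apply_iff.2 fun y => ?_
    simp only [fderiv_jacobi_apply]
    fun_prop
  let q : V → ℝ := fun y => traceL V (jacobi (covCurv Γ y) v₀ ∘L jacobi (covCurv Γ y) v₀)
  have hq : ContDiff ℝ ∞ q := (traceL V).contDiff.comp (hJ.clm_comp hJ)
  let φ : V → V →L[ℝ] ℝ := fun y => traceL V ∘L
    (ContinuousLinearMap.compL ℝ V V V (jacobi (covCurv Γ y) v₀)) ∘L
      (fderiv ℝ (jacobi (covCurv Γ y)) v₀)
  have hφ : ContDiff ℝ ∞ φ := contDiff_const.clm_comp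
    (((ContinuousLinearMap.compL ℝ V V V).contDiff.comp hJ).clm_comp hJ')
  have hqx : 0 < q x := by
    have : q x = _ := hκ x hx v₀
    rw [this]; positivity
  have hqpos : ∀ᶠ y in 𝓝 x, 0 < q y := hq.continuous.continuousAt.eventually (lt_mem_nhds hqx)
  let e : ∀ y, V ≃L[ℝ] (V →L[ℝ] ℝ) := fun y => LinearEquiv.toContinuousLinearEquiv
    (LinearEquiv.ofInjectiveOfFinrankEq (G y : V →ₗ[ℝ] V →L[ℝ] ℝ)
      ((injective_iff_map_eq_zero _).2 fun v hv => hG y v fun w => congrArg (fun f => f w) hv)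
      (Subspace.dual_finrank_eq.symm.trans (LinearMap.toContinuousLinearMap (𝕜 := ℝ)
        (E := V) (F' := ℝ)).finrank_eq))
  have he : ∀ y, (e y : V →L[ℝ] V →L[ℝ] ℝ) = G y := fun y => by
    ext; rfl
  refine ⟨fun y => (G y).inverse ((3 * (q y ^ (1 / 6 : ℝ)) ^ 5)⁻¹ • φ y), ?_, ?_⟩
  · have h1 : DifferentiableAt ℝ (fun y => (G y).inverse) x := by
      have h3 := (contDiffAt_map_inverse (𝕜 := ℝ) (n := 1) (e x))
      rw [he] at h3
      exact (h3.differentiableAt (by simp)).comp x (h.differentiable_metric x)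
    have h2 : DifferentiableAt ℝ (fun y => q y ^ (1 / 6 : ℝ)) x :=
      (hq.differentiable (by simp) x).rpow_const (Or.inl hqx.ne')
    have h4 : DifferentiableAt ℝ φ x := hφ.differentiable (by simp) x
    refine h1.clm_apply (DifferentiableAt.smul (((h2.pow 5).const_mul 3).inv ?_) h4)
    exact mul_ne_zero three_ne_zero (pow_ne_zero 5 (Real.rpow_pos_of_pos hqx (1 / 6)).ne')
  · filter_upwards [hqpos, hD.mem_nhds hx] with y hy hyD
    have hr := Real.rpow_pos_of_pos hy (1 / 6)
    refine eq_or_eq_neg_of_apply_pow_six (hG y) (v₀ := v₀) hr.ne' ?_ fun u => ?_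
    · rw [← hκ y hyD, ← Real.rpow_natCast, ← Real.rpow_mul hy.le]; norm_num; rfl
    · have h5 : ∀ ψ, G y ((G y).inverse ψ) = ψ := fun ψ => by
        rw [← he, ContinuousLinearMap.inverse_equiv]; simp
      have h6 : φ y u = 3 * G y (κ y) v₀ ^ 5 * G y (κ y) u :=
        traceL_jacobi_fderiv (hκ y hyD) v₀ u
      rw [h5, smul_apply, h6, smul_eq_mul]
      field_simp

lemma IsLeviCivita.parallel_of_apply_pow_six (h : IsLeviCivita G Γ)
    (hG : ∀ v, (∀ w, G x v w = 0) → v = 0) (h2 : IsTwoSymmetricAt Γ x) {k : V → V}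
    (hk : DifferentiableAt ℝ k x) (hk0 : k x ≠ 0)
    (hq : ∀ᶠ y in 𝓝 x, ∀ v, traceL V (jacobi (covCurv Γ y) v ∘L jacobi (covCurv Γ y) v) =
      G y (k y) v ^ 6) (Z : V) : fderiv ℝ k x Z + Γ x Z (k x) = 0 := by
  have hGd := h.differentiable_metric
  have key : ∀ v, G x (k x) v ≠ 0 → G x (fderiv ℝ k x Z + Γ x Z (k x)) v = 0 := fun v hv => by
    have h1 := h2.fderiv_traceL_jacobi h v Z
    rw [traceL_jacobi_fderiv hq.self_of_nhds,
      Filter.EventuallyEq.fderiv_eq (hq.mono fun y hy => hy v)] at h1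
    have hd : DifferentiableAt ℝ (fun y => G y (k y) v) x := by fun_prop
    have h3 : HasFDerivAt (fun y => G y (k y) v ^ 6) _ x := hd.hasFDerivAt.pow 6
    rw [h3.fderiv, smul_apply] at h1
    simp (disch := fun_prop) only [fderiv_clm_apply_apply, fderiv_const_apply_apply, map_zero,
      add_zero, add_apply, h.compat] at h1
    rw [map_add, add_apply]
    refine (mul_eq_zero.1 (?_ : (6 * G x (k x) v ^ 5) * _ = 0)).resolve_left (by positivity)
    simp only [nsmul_eq_mul, smul_eq_mul] at h1
    norm_num at h1
    linear_combination h1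
  obtain ⟨v₀, hv₀⟩ : ∃ v₀, G x (k x) v₀ ≠ 0 := by
    by_contra! hc
    exact hk0 (hG _ hc)
  refine hG _ fun v => ?_
  by_cases hv : G x (k x) v = 0
  · have := key (v + v₀) (by rwa [map_add, hv, zero_add])
    rwa [map_add, key v₀ hv₀, add_zero] at this
  · exact key v hv

/-- If `∇R` is parallel and nonzero on a simply connected open set of a Lorentzian manifold,
then that set carries a parallel null vector field. -/
lemma IsLeviCivita.exists_parallel_null {ι : Type*} [Fintype ι] [DecidableEq ι]
    (h : IsLeviCivita G Γ) (hb : ∀ x, ∃ (b : Basis ι ℝ V) (i₀ : ι), IsLorentzBasis (G x) b i₀)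
    {D : Set V} (hD : IsOpen D) [SimplyConnectedSpace D] (h2 : ∀ y ∈ D, IsTwoSymmetricAt Γ y)
    (hne : ∀ x ∈ D, covCurv Γ x ≠ 0) :
    ∃ k : V → V, ∀ x ∈ D, k x ≠ 0 ∧ G x (k x) (k x) = 0 ∧ DifferentiableAt ℝ k x ∧
      ∀ Z, fderiv ℝ k x Z + Γ x Z (k x) = 0 := by
  have hG : ∀ x v, (∀ w, G x v w = 0) → v = 0 := fun x v hv => by
    obtain ⟨b, i₀, hb⟩ := hb x
    exact hb.eq_zero hv
  have hex : ∀ x, ∃ κ : V, x ∈ D → κ ≠ 0 ∧ G x κ κ = 0 ∧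
      ∀ v, traceL V (jacobi (covCurv Γ x) v ∘L jacobi (covCurv Γ x) v) = G x κ v ^ 6 := fun x => by
    by_cases hx : x ∈ D
    · obtain ⟨b, i₀, hb⟩ := hb x
      obtain ⟨κ, hκ⟩ :=
          (h.isTwoSymmetricJet (Filter.Eventually.mono (hD.mem_nhds hx) h2)).exists_null_trace
            hb (hne x hx)
      exact ⟨κ, fun _ => hκ⟩
    · exact ⟨0, fun hx' => absurd hx' hx⟩
  choose κ hκ using hex
  have hloc : ∀ x ∈ D, ∃ σ : V → V, DifferentiableAt ℝ σ x ∧ ∀ᶠ y in 𝓝 x, σ y = κ y ∨ σ y = -κ y :=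
    fun x hx => h.exists_local_sign_choice hG hD (fun y hy => (hκ y hy).2.2) hx (hκ x hx).1
  have := hD.locallyPathConnectedSpace
  obtain ⟨s, hs, hsκ⟩ := exists_continuous_sign_choice (A := D) (fun y => κ y)
    (fun y => (hκ y y.2).1) fun y => by
      obtain ⟨σ, hσ, hσκ⟩ := hloc y y.2
      exact ⟨fun z => σ z, hσ.continuousAt.comp continuous_subtype_val.continuousAt,
        continuous_subtype_val.continuousAt.eventually hσκ⟩
  classical
  let k : V → V := fun x => if hx : x ∈ D then s ⟨x, hx⟩ else 0
  have hkκ : ∀ x ∈ D, k x = κ x ∨ k x = -κ x := fun x hx => by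
    simp only [k, hx, dif_pos]; exact hsκ ⟨x, hx⟩
  have hkc : ContinuousOn k D := by
    rw [continuousOn_iff_continuous_domRestrict]
    convert hs using 1
    ext1 y
    simp [k]
  have hk0 : ∀ x ∈ D, k x ≠ 0 := fun x hx => by
    rcases hkκ x hx with e | e <;> rw [e]
    · exact (hκ x hx).1
    · exact neg_ne_zero.2 (hκ x hx).1
  have hkd : ∀ x ∈ D, DifferentiableAt ℝ k x := fun x hx => by
    obtain ⟨σ, hσ, hσκ⟩ := hloc x hx
    have hkx := hkc.continuousAt (hD.mem_nhds hx)
    have hσk : ∀ᶠ y in 𝓝 x, k y = σ y ∨ k y = -σ y := by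
      filter_upwards [hσκ, hD.mem_nhds hx] with y hy hyD
      rcases hkκ y hyD with e | e <;> rcases hy with e' | e' <;> simp [e, e']
    rcases hσk.self_of_nhds with e | e
    · have hne : ∀ᶠ y in 𝓝 x, k y + σ y ≠ 0 := by
        refine (hkx.add hσ.continuousAt).eventually_ne ?_
        rw [Pi.add_apply, ← e, ← two_smul ℝ]
        exact smul_ne_zero two_ne_zero (hk0 x hx)
      refine hσ.congr_of_eventuallyEq ?_
      filter_upwards [hσk, hne] with y hy hy'
      exact hy.resolve_right fun e => hy' (by rw [e, neg_add_cancel])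
    · have hne : ∀ᶠ y in 𝓝 x, k y - σ y ≠ 0 := by
        refine (hkx.sub hσ.continuousAt).eventually_ne ?_
        rw [Pi.sub_apply, ← neg_eq_iff_eq_neg.2 e, sub_neg_eq_add, ← two_smul ℝ]
        exact smul_ne_zero two_ne_zero (hk0 x hx)
      refine hσ.neg.congr_of_eventuallyEq ?_
      filter_upwards [hσk, hne] with y hy hy'
      exact hy.resolve_left fun e => hy' (by rw [e, sub_self])
  refine ⟨k, fun x hx => ⟨hk0 x hx, ?_, hkd x hx, ?_⟩⟩
  · rcases hkκ x hx with e | e <;> simp [e, (hκ x hx).2.1]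
  · refine h.parallel_of_apply_pow_six (hG x) (h2 x hx) (hkd x hx) (hk0 x hx) ?_
    filter_upwards [hD.mem_nhds hx] with y hy v
    rw [(hκ y hy).2.2]
    rcases hkκ y hy with e | e <;> rw [e]
    rw [map_neg, neg_apply, Even.neg_pow (by decide)]

end ParallelNull

section Coordinates

open scoped ContDiff Topology
open Module

set_option maxSynthPendingDepth 3

variable {n : ℕ}

lemma sum_mul_apply_single {f : Pt n → ℝ} (hf : IsLinearMap ℝ f) (w : Pt n) :
    ∑ ρ, w ρ * f (Pi.single ρ 1) = f w := by
  calc _ = hf.mk' f (∑ ρ, w ρ • Pi.single ρ (1 : ℝ)) := by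
        simp only [map_sum, map_smul, smul_eq_mul, IsLinearMap.mk'_apply]
    _ = f w := by rw [← pi_eq_sum_univ' w]; rfl

lemma IsLinearMap.eq_of_apply_single {F : Type*} [AddCommGroup F] [Module ℝ F] {f h : Pt n → F}
    (hf : IsLinearMap ℝ f) (hh : IsLinearMap ℝ h)
    (e : ∀ i, f (Pi.single i 1) = h (Pi.single i 1)) (v : Pt n) : f v = h v := by
  have : hf.mk' f = hh.mk' h := (Pi.basisFun ℝ (Fin n)).ext fun i => by simpa using e i
  exact LinearMap.congr_fun this v

/-- The bilinear map with given coefficients in the standard basis. -/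
def bilinOfCoeff {F : Type*} [NormedAddCommGroup F] [NormedSpace ℝ F] (c : Fin n → Fin n → F) :
    Pt n →L[ℝ] Pt n →L[ℝ] F :=
  ∑ i, ∑ j, (ContinuousLinearMap.proj (R := ℝ) (φ := fun _ : Fin n => ℝ) i).smulRight
    ((ContinuousLinearMap.proj (R := ℝ) (φ := fun _ : Fin n => ℝ) j).smulRight (c i j))

lemma bilinOfCoeff_apply {F : Type*} [NormedAddCommGroup F] [NormedSpace ℝ F]
    (c : Fin n → Fin n → F) (u v : Pt n) : bilinOfCoeff c u v = ∑ i, ∑ j, u i • v j • c i j := by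
  simp [bilinOfCoeff]

lemma bilinOfCoeff_single {F : Type*} [NormedAddCommGroup F] [NormedSpace ℝ F]
    (c : Fin n → Fin n → F) (i j : Fin n) :
    bilinOfCoeff c (Pi.single i 1) (Pi.single j 1) = c i j := by
  rw [bilinOfCoeff_apply, Finset.sum_eq_single i, Finset.sum_eq_single j] <;>
    simp +contextual

lemma contDiff_bilinOfCoeff {F : Type*} [NormedAddCommGroup F] [NormedSpace ℝ F]
    {c : Pt n → Fin n → Fin n → F} (hc : ∀ i j, ContDiff ℝ ∞ fun x => c x i j) :
    ContDiff ℝ ∞ fun x => bilinOfCoeff (c x) := by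
  refine contDiff_clm_apply_iff.2 fun u => contDiff_clm_apply_iff.2 fun v => ?_
  simp only [bilinOfCoeff_apply]
  fun_prop

/-- The metric as a field of bilinear forms. -/
def metricForm (g : Pt n → Fin n → Fin n → ℝ) (x : Pt n) : Pt n →L[ℝ] Pt n →L[ℝ] ℝ :=
  bilinOfCoeff (g x)

/-- The Levi-Civita connection form in the chart. -/
def connForm (g ginv : Pt n → Fin n → Fin n → ℝ) (x : Pt n) : Pt n →L[ℝ] Pt n →L[ℝ] Pt n :=
  bilinOfCoeff fun β γ α => christoffel g ginv x α β γ

lemma metricForm_single (g : Pt n → Fin n → Fin n → ℝ) (x : Pt n) (i j : Fin n) :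
    metricForm g x (Pi.single i 1) (Pi.single j 1) = g x i j := bilinOfCoeff_single _ i j

lemma metricForm_apply (g : Pt n → Fin n → Fin n → ℝ) (x u v : Pt n) :
    metricForm g x u v = ∑ μ, ∑ ν, g x μ ν * u μ * v ν := by
  rw [metricForm, bilinOfCoeff_apply]
  refine Finset.sum_congr rfl fun i _ => Finset.sum_congr rfl fun j _ => ?_
  simp only [smul_eq_mul]; ring

lemma connForm_single (g ginv : Pt n → Fin n → Fin n → ℝ) (x : Pt n) (α β γ : Fin n) :
    connForm g ginv x (Pi.single β 1) (Pi.single γ 1) α = christoffel g ginv x α β γ :=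
  congrFun (bilinOfCoeff_single _ β γ) α

lemma metricForm_single_left (g : Pt n → Fin n → Fin n → ℝ) (x v : Pt n) (i : Fin n) :
    metricForm g x (Pi.single i 1) v = ∑ ρ, g x i ρ * v ρ := by
  rw [← sum_mul_apply_single (f := fun v => metricForm g x (Pi.single i 1) v)
    ⟨fun _ _ => map_add _ _ _, fun _ _ => map_smul _ _ _⟩ v]
  simp only [metricForm_single, mul_comm]

lemma connForm_single_left (g ginv : Pt n → Fin n → Fin n → ℝ) (x v : Pt n) (α β : Fin n) :
    connForm g ginv x (Pi.single β 1) v α = ∑ ρ, christoffel g ginv x α β ρ * v ρ := by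
  rw [← sum_mul_apply_single (f := fun v => connForm g ginv x (Pi.single β 1) v α)
    ⟨fun _ _ => by rw [map_add, Pi.add_apply], fun _ _ => by rw [map_smul, Pi.smul_apply]⟩ v]
  simp only [connForm_single, mul_comm]

variable {g ginv : Pt n → Fin n → Fin n → ℝ}

lemma IsMetric.contDiff_metricForm (hg : IsMetric g ginv) : ContDiff ℝ ∞ (metricForm g) :=
  contDiff_bilinOfCoeff hg.2.1

lemma contDiff_pd {f : Pt n → ℝ} (hf : ContDiff ℝ ∞ f) (i : Fin n) : ContDiff ℝ ∞ (pd i f) :=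
  (hf.fderiv_right (m := ∞) (by simp)).clm_apply contDiff_const

lemma IsMetric.contDiff_christoffel (hg : IsMetric g ginv) (α β γ : Fin n) :
    ContDiff ℝ ∞ fun x => christoffel g ginv x α β γ := by
  have h1 : ∀ i μ ν, ContDiff ℝ ∞ fun x => pd i (fun y => g y μ ν) x :=
    fun i μ ν => contDiff_pd (hg.2.1 μ ν) i
  have h2 := hg.2.2.1
  unfold christoffel
  fun_prop

lemma IsMetric.contDiff_connForm (hg : IsMetric g ginv) : ContDiff ℝ ∞ (connForm g ginv) :=
  contDiff_bilinOfCoeff fun β γ => contDiff_pi.2 fun α => hg.contDiff_christoffel α β γ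

lemma IsMetric.metric_mul_inv (hg : IsMetric g ginv) (x : Pt n) (μ ν : Fin n) :
    ∑ ρ, g x μ ρ * ginv x ρ ν = if μ = ν then (1 : ℝ) else 0 := by
  have h1 : Matrix.of (ginv x) * Matrix.of (g x) = 1 := by
    ext i j
    rw [Matrix.mul_apply, Matrix.one_apply]
    exact hg.2.2.2 x i j
  rw [mul_eq_one_comm] at h1
  have h2 := congrFun (congrFun h1 μ) ν
  rwa [Matrix.mul_apply, Matrix.one_apply] at h2

lemma IsMetric.sum_metric_mul_christoffel (hg : IsMetric g ginv) (x : Pt n) (σ β γ : Fin n) :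
    ∑ α, g x σ α * christoffel g ginv x α β γ =
      (1 / 2) * (pd β (fun y => g y σ γ) x + pd γ (fun y => g y σ β) x -
        pd σ (fun y => g y β γ) x) := by
  simp only [christoffel]
  have h : ∀ c : Fin n → ℝ, ∑ α, g x σ α * (1 / 2 * ∑ ρ, ginv x α ρ * c ρ) = 1 / 2 * c σ := by
    intro c
    calc _ = 1 / 2 * ∑ ρ, (∑ α, g x σ α * ginv x α ρ) * c ρ := by
          simp only [Finset.mul_sum, Finset.sum_mul]
          rw [Finset.sum_comm]
          exact Finset.sum_congr rfl fun _ _ => Finset.sum_congr rfl fun _ _ => by ring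
      _ = _ := by simp [hg.metric_mul_inv]
  exact h _

lemma IsMetric.isLeviCivita (hg : IsMetric g ginv) :
    IsLeviCivita (metricForm g) (connForm g ginv) where
  contDiff_metric := hg.contDiff_metricForm
  contDiff := hg.contDiff_connForm
  metric_symm x u v := by
    simp only [metricForm_apply]
    rw [Finset.sum_comm]
    refine Finset.sum_congr rfl fun i _ => Finset.sum_congr rfl fun j _ => ?_
    rw [hg.1 x i j]; ring
  torsion_free x u v := by
    simp only [connForm, bilinOfCoeff_apply]
    rw [Finset.sum_comm]
    refine Finset.sum_congr rfl fun i _ => Finset.sum_congr rfl fun j _ => ?_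
    rw [smul_comm]
    congr 2
    ext α
    have : (fun y => g y i j) = fun y => g y j i := funext fun y => hg.1 y i j
    simp only [christoffel, this]
    congr 1
    exact Finset.sum_congr rfl fun ρ _ => by ring
  compat x w u v := by
    have hGd : Differentiable ℝ (metricForm g) :=
      hg.contDiff_metricForm.differentiable (by simp)
    have hs : ∀ u v, metricForm g x u v = metricForm g x v u := fun u v => by
      simp only [metricForm_apply]
      rw [Finset.sum_comm]
      refine Finset.sum_congr rfl fun i _ => Finset.sum_congr rfl fun j _ => ?_
      rw [hg.1 x i j]; ring
    refine IsLinearMap.eq_of_apply_single (f := fun v => fderiv ℝ (metricForm g) x w u v)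
      (h := fun v => metricForm g x (connForm g ginv x w u) v +
        metricForm g x u (connForm g ginv x w v))
      ⟨fun a c => by simp only [map_add], fun r a => by simp only [map_smul]⟩
      ⟨fun a c => by simp only [map_add]; ring, fun r a => by simp only [map_smul, smul_add]⟩
      (fun k => ?_) v
    refine IsLinearMap.eq_of_apply_single
      (f := fun u => fderiv ℝ (metricForm g) x w u (Pi.single k 1))
      (h := fun u => metricForm g x (connForm g ginv x w u) (Pi.single k 1) +
        metricForm g x u (connForm g ginv x w (Pi.single k 1)))
      ⟨fun a c => by simp only [map_add, add_apply],
        fun r a => by simp only [map_smul, smul_apply]⟩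
      ⟨fun a c => by simp only [map_add, add_apply]; ring,
        fun r a => by simp only [map_smul, smul_apply, smul_add]⟩
      (fun j => ?_) u
    refine IsLinearMap.eq_of_apply_single
      (f := fun w => fderiv ℝ (metricForm g) x w (Pi.single j 1) (Pi.single k 1))
      (h := fun w => metricForm g x (connForm g ginv x w (Pi.single j 1)) (Pi.single k 1) +
        metricForm g x (Pi.single j 1) (connForm g ginv x w (Pi.single k 1)))
      ⟨fun a c => by simp only [map_add, add_apply],
        fun r a => by simp only [map_smul, smul_apply]⟩
      ⟨fun a c => by simp only [map_add, add_apply]; ring,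
        fun r a => by simp only [map_smul, smul_apply, smul_add]⟩
      (fun i => ?_) w
    have e := congrArg (fun f => fderiv ℝ f x (Pi.single i 1))
      (funext fun y => metricForm_single g y j k)
    simp (disch := fun_prop) only [fderiv_clm_apply_apply, fderiv_const_apply_apply, map_zero,
      add_zero] at e
    rw [e, hs, metricForm_single_left, metricForm_single_left]
    simp only [connForm_single]
    rw [hg.sum_metric_mul_christoffel, hg.sum_metric_mul_christoffel]
    have hsym : ∀ j k, (fun y => g y j k) = fun y => g y k j :=
      fun j k => funext fun y => hg.1 y j k
    rw [hsym k j, hsym k i, hsym j i]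
    simp only [pd]
    ring

lemma IsMetric.riemann_eq (hg : IsMetric g ginv) (x : Pt n) (idx : Fin 4 → Fin n) :
    riemann g ginv x idx = metricForm g x (Pi.single (idx 0) 1)
      (curv (connForm g ginv) x (Pi.single (idx 2) 1) (Pi.single (idx 3) 1)
        (Pi.single (idx 1) 1)) := by
  have hΓ := hg.isLeviCivita.differentiable
  have hd : ∀ α β γ δ : Fin n, fderiv ℝ (connForm g ginv) x (Pi.single γ 1) (Pi.single δ 1)
      (Pi.single β 1) α = pd γ (fun y => christoffel g ginv y α δ β) x := fun α β γ δ => by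
    have e : (fun y => connForm g ginv y (Pi.single δ 1) (Pi.single β 1)) =
        fun y α => christoffel g ginv y α δ β :=
      funext fun y => funext fun α => connForm_single g ginv y α δ β
    have e1 := congrArg (fun f : Pt n → Pt n => fderiv ℝ f x (Pi.single γ 1)) e
    simp (disch := fun_prop) only [fderiv_clm_apply_apply, fderiv_const_apply_apply, map_zero,
      add_zero] at e1
    rw [e1, fderiv_pi fun α => (hg.contDiff_christoffel α δ β).differentiable (by simp) x]
    rfl
  have hv : ∀ δ β, connForm g ginv x (Pi.single δ 1) (Pi.single β 1) =
      fun ρ => christoffel g ginv x ρ δ β := fun δ β =>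
    funext fun ρ => connForm_single g ginv x ρ δ β
  rw [riemann, metricForm_single_left]
  refine Finset.sum_congr rfl fun ρ _ => ?_
  rw [curv_apply, riemannUp]
  simp only [Pi.add_apply, Pi.sub_apply, hd, hv, connForm_single_left,
    Finset.sum_sub_distrib]

lemma covDVec_eq {k : Pt n → Pt n} {x : Pt n} (hk : DifferentiableAt ℝ k x) (l μ : Fin n) :
    covDVec g ginv k x l μ =
      (fderiv ℝ k x (Pi.single l 1) + connForm g ginv x (Pi.single l 1) (k x)) μ := by
  rw [Pi.add_apply, connForm_single_left, covDVec, pd,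
    (hasFDerivAt_pi'.1 hk.hasFDerivAt μ).fderiv]
  rfl

lemma sum_christoffel_mul (x : Pt n) (a c : Fin n) {f : Pt n → ℝ} (hf : IsLinearMap ℝ f) :
    ∑ ρ, christoffel g ginv x ρ a c * f (Pi.single ρ 1) =
      f (connForm g ginv x (Pi.single a 1) (Pi.single c 1)) := by
  rw [← sum_mul_apply_single hf]
  simp only [connForm_single]

lemma IsMetric.covD_riemann_eq (hg : IsMetric g ginv) (x : Pt n) (idx : Fin 5 → Fin n) :
    covD g ginv (riemann g ginv) x idx = metricForm g x (Pi.single (idx 1) 1)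
      (covCurv (connForm g ginv) x (Pi.single (idx 0) 1) (Pi.single (idx 3) 1)
        (Pi.single (idx 4) 1) (Pi.single (idx 2) 1)) := by
  have hL := hg.isLeviCivita
  have hG := hL.differentiable_metric
  have hR := hL.differentiable_curv
  have e1 : (Fin.succ 0 : Fin 5) = 1 := rfl
  have e2 : (Fin.succ 1 : Fin 5) = 2 := rfl
  have e3 : (Fin.succ 2 : Fin 5) = 3 := rfl
  have e4 : (Fin.succ 3 : Fin 5) = 4 := rfl
  simp only [covD, pd, hg.riemann_eq, Fin.sum_univ_four]
  simp (disch := fun_prop) only [fderiv_clm_apply_apply, fderiv_const_apply_apply, map_zero,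
      add_zero, hL.compat]
  simp (disch := decide) only [Function.update_self, Function.update_of_ne, e1, e2, e3, e4]
  set Γ := connForm g ginv
  have s1 := sum_christoffel_mul (g := g) (ginv := ginv) x (idx 0) (idx 1)
    (f := fun v => metricForm g x v (curv Γ x (Pi.single (idx 3) 1) (Pi.single (idx 4) 1)
      (Pi.single (idx 2) 1)))
    ⟨fun a c => by simp only [map_add, add_apply],
      fun r a => by simp only [map_smul, smul_apply]⟩
  have s2 := sum_christoffel_mul (g := g) (ginv := ginv) x (idx 0) (idx 2)
    (f := fun v => metricForm g x (Pi.single (idx 1) 1) (curv Γ x (Pi.single (idx 3) 1)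
      (Pi.single (idx 4) 1) v))
    ⟨fun a c => by simp only [map_add], fun r a => by simp only [map_smul]⟩
  have s3 := sum_christoffel_mul (g := g) (ginv := ginv) x (idx 0) (idx 3)
    (f := fun v => metricForm g x (Pi.single (idx 1) 1) (curv Γ x v
      (Pi.single (idx 4) 1) (Pi.single (idx 2) 1)))
    ⟨fun a c => by simp only [map_add, add_apply],
      fun r a => by simp only [map_smul, smul_apply]⟩
  have s4 := sum_christoffel_mul (g := g) (ginv := ginv) x (idx 0) (idx 4)
    (f := fun v => metricForm g x (Pi.single (idx 1) 1) (curv Γ x (Pi.single (idx 3) 1) v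
      (Pi.single (idx 2) 1)))
    ⟨fun a c => by simp only [map_add, add_apply],
      fun r a => by simp only [map_smul, smul_apply]⟩
  beta_reduce at s1 s2 s3 s4
  rw [s1, s2, s3, s4, covCurv_apply]
  simp only [map_add, map_sub]
  ring

set_option maxHeartbeats 2000000 in
lemma IsMetric.covD_eq_of_covCurv (hg : IsMetric g ginv) {S : Tensor n 5}
    (hS : ∀ x idx, S x idx = metricForm g x (Pi.single (idx 1) 1)
      (covCurv (connForm g ginv) x (Pi.single (idx 0) 1) (Pi.single (idx 3) 1)
        (Pi.single (idx 4) 1) (Pi.single (idx 2) 1))) (x : Pt n) (idx : Fin 6 → Fin n) :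
    covD g ginv S x idx = metricForm g x (Pi.single (idx 2) 1)
      (fderiv ℝ (covCurv (connForm g ginv)) x (Pi.single (idx 0) 1) (Pi.single (idx 1) 1)
        (Pi.single (idx 4) 1) (Pi.single (idx 5) 1) (Pi.single (idx 3) 1) -
      (covCurv (connForm g ginv) x
          (connForm g ginv x (Pi.single (idx 0) 1) (Pi.single (idx 1) 1))
          (Pi.single (idx 4) 1) (Pi.single (idx 5) 1) (Pi.single (idx 3) 1) +
        covCurv (connForm g ginv) x (Pi.single (idx 1) 1)
          (connForm g ginv x (Pi.single (idx 0) 1) (Pi.single (idx 4) 1))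
          (Pi.single (idx 5) 1) (Pi.single (idx 3) 1) +
        covCurv (connForm g ginv) x (Pi.single (idx 1) 1) (Pi.single (idx 4) 1)
          (connForm g ginv x (Pi.single (idx 0) 1) (Pi.single (idx 5) 1)) (Pi.single (idx 3) 1) +
        covCurv (connForm g ginv) x (Pi.single (idx 1) 1) (Pi.single (idx 4) 1)
          (Pi.single (idx 5) 1) (connForm g ginv x (Pi.single (idx 0) 1) (Pi.single (idx 3) 1)) -
        connForm g ginv x (Pi.single (idx 0) 1) (covCurv (connForm g ginv) x (Pi.single (idx 1) 1)
          (Pi.single (idx 4) 1) (Pi.single (idx 5) 1) (Pi.single (idx 3) 1)))) := by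
  have hL := hg.isLeviCivita
  have hG := hL.differentiable_metric
  have hT := hL.differentiable_covCurv
  have e1 : (Fin.succ 0 : Fin 6) = 1 := rfl
  have e2 : (Fin.succ 1 : Fin 6) = 2 := rfl
  have e3 : (Fin.succ 2 : Fin 6) = 3 := rfl
  have e4 : (Fin.succ 3 : Fin 6) = 4 := rfl
  have e5 : (Fin.succ 4 : Fin 6) = 5 := rfl
  simp only [covD, pd, hS, Fin.sum_univ_five]
  simp (disch := fun_prop) only [fderiv_clm_apply_apply, fderiv_const_apply_apply, map_zero,
      add_zero, hL.compat]
  simp (disch := decide) only [Function.update_self, Function.update_of_ne, e1, e2, e3, e4, e5]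
  set Γ := connForm g ginv
  have s1 := sum_christoffel_mul (g := g) (ginv := ginv) x (idx 0) (idx 1)
    (f := fun v => metricForm g x (Pi.single (idx 2) 1) (covCurv Γ x v (Pi.single (idx 4) 1)
      (Pi.single (idx 5) 1) (Pi.single (idx 3) 1)))
    ⟨fun a c => by simp only [map_add, add_apply],
      fun r a => by simp only [map_smul, smul_apply]⟩
  have s2 := sum_christoffel_mul (g := g) (ginv := ginv) x (idx 0) (idx 2)
    (f := fun v => metricForm g x v (covCurv Γ x (Pi.single (idx 1) 1) (Pi.single (idx 4) 1)
      (Pi.single (idx 5) 1) (Pi.single (idx 3) 1)))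
    ⟨fun a c => by simp only [map_add, add_apply],
      fun r a => by simp only [map_smul, smul_apply]⟩
  have s3 := sum_christoffel_mul (g := g) (ginv := ginv) x (idx 0) (idx 3)
    (f := fun v => metricForm g x (Pi.single (idx 2) 1) (covCurv Γ x (Pi.single (idx 1) 1)
      (Pi.single (idx 4) 1) (Pi.single (idx 5) 1) v))
    ⟨fun a c => by simp only [map_add], fun r a => by simp only [map_smul]⟩
  have s4 := sum_christoffel_mul (g := g) (ginv := ginv) x (idx 0) (idx 4)
    (f := fun v => metricForm g x (Pi.single (idx 2) 1) (covCurv Γ x (Pi.single (idx 1) 1) v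
      (Pi.single (idx 5) 1) (Pi.single (idx 3) 1)))
    ⟨fun a c => by simp only [map_add, add_apply],
      fun r a => by simp only [map_smul, smul_apply]⟩
  have s5 := sum_christoffel_mul (g := g) (ginv := ginv) x (idx 0) (idx 5)
    (f := fun v => metricForm g x (Pi.single (idx 2) 1) (covCurv Γ x (Pi.single (idx 1) 1)
      (Pi.single (idx 4) 1) v (Pi.single (idx 3) 1)))
    ⟨fun a c => by simp only [map_add, add_apply],
      fun r a => by simp only [map_smul, smul_apply]⟩
  beta_reduce at s1 s2 s3 s4 s5
  rw [s1, s2, s3, s4, s5]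
  simp only [map_add, map_sub]
  ring

lemma single_induction {p : Pt n → Prop} (add : ∀ v w, p v → p w → p (v + w))
    (smul : ∀ (r : ℝ) v, p v → p (r • v)) (zero : p 0) (single : ∀ i, p (Pi.single i 1))
    (v : Pt n) : p v := by
  rw [pi_eq_sum_univ' v]
  exact Finset.sum_induction _ p add zero fun i _ => smul _ _ (single i)

lemma IsMetric.eq_zero_of_metricForm (hg : IsMetric g ginv) {x v : Pt n}
    (h : ∀ i, metricForm g x (Pi.single i 1) v = 0) : v = 0 := by
  funext μ
  calc v μ = ∑ ρ, (∑ i, ginv x μ i * g x i ρ) * v ρ := by simp [hg.2.2.2]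
    _ = ∑ i, ginv x μ i * ∑ ρ, g x i ρ * v ρ := by
        simp only [Finset.mul_sum, Finset.sum_mul]
        rw [Finset.sum_comm]
        exact Finset.sum_congr rfl fun _ _ => Finset.sum_congr rfl fun _ _ => by ring
    _ = 0 := by simp only [← metricForm_single_left, h, mul_zero, Finset.sum_const_zero]

set_option maxHeartbeats 2000000 in
lemma IsMetric.isTwoSymmetricAt (hg : IsMetric g ginv) {x : Pt n}
    (h : ∀ idx, covD g ginv (covD g ginv (riemann g ginv)) x idx = 0) :
    IsTwoSymmetricAt (connForm g ginv) x := by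
  intro W E X Y Z
  set Γ := connForm g ginv with hΓ
  induction W using single_induction with
  | add v w hv hw => simp only [map_add, add_apply, hv, hw]; abel
  | smul r v hv => simp only [map_smul, smul_apply, hv, smul_add, smul_sub]
  | zero => simp only [map_zero, zero_apply, add_zero, sub_zero]
  | single i =>
  induction E using single_induction with
  | add v w hv hw => simp only [map_add, add_apply, hv, hw]; abel
  | smul r v hv => simp only [map_smul, smul_apply, hv, smul_add, smul_sub]
  | zero => simp only [map_zero, zero_apply, add_zero, sub_zero]
  | single j =>
  induction X using single_induction with
  | add v w hv hw => simp only [map_add, add_apply, hv, hw]; abel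
  | smul r v hv => simp only [map_smul, smul_apply, hv, smul_add, smul_sub]
  | zero => simp only [map_zero, zero_apply, add_zero, sub_zero]
  | single k =>
  induction Y using single_induction with
  | add v w hv hw => simp only [map_add, add_apply, hv, hw]; abel
  | smul r v hv => simp only [map_smul, smul_apply, hv, smul_add, smul_sub]
  | zero => simp only [map_zero, zero_apply, add_zero, sub_zero]
  | single l =>
  induction Z using single_induction with
  | add v w hv hw => simp only [map_add, hv, hw]; abel
  | smul r v hv => simp only [map_smul, hv, smul_add, smul_sub]
  | zero => simp only [map_zero, add_zero, sub_zero]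
  | single m =>
  refine sub_eq_zero.1 (hg.eq_zero_of_metricForm (x := x) fun a => ?_)
  exact (hg.covD_eq_of_covCurv hg.covD_riemann_eq x ![i, j, a, m, k, l]).symm.trans (h _)

lemma IsLorentzian.exists_isLorentzBasis [NeZero n] (hL : IsLorentzian g) (x : Pt n) :
    ∃ (b : Basis (Fin n) ℝ (Pt n)) (i₀ : Fin n), IsLorentzBasis (metricForm g x) b i₀ := by
  obtain ⟨e, he⟩ := hL x
  have hGe : ∀ i j, metricForm g x (e i) (e j) =
      if i = j then (if i = 0 then (-1 : ℝ) else 1) else 0 := fun i j => by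
    rw [metricForm_apply, he]
    simp only [Fin.ext_iff, Fin.val_zero]
  have hli : LinearIndependent ℝ e := by
    refine Fintype.linearIndependent_iff.2 fun c hc j => ?_
    have := congrArg (fun v => metricForm g x v (e j)) hc
    simp only [map_sum, map_smul, sum_apply, smul_apply, hGe, map_zero, zero_apply,
      smul_eq_mul, mul_ite, mul_zero] at this
    rw [Finset.sum_ite_eq' Finset.univ j] at this
    split_ifs at this <;> simp_all
  have : Nonempty (Fin n) := ⟨0⟩
  refine ⟨basisOfLinearIndependentOfCardEqFinrank hli (by simp), 0, fun i j => ?_⟩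
  rw [coe_basisOfLinearIndependentOfCardEqFinrank, hGe]

end Coordinates

/-- Let `D` be a simply connected domain of an `n`-dimensional
2-symmetric Lorentzian manifold.  If there is no null parallel vector field on `D`,
then `(D,g)` is either Ricci-flat or locally symmetric. -/
theorem stmt17 {n : ℕ} (g ginv : Pt n → Fin n → Fin n → ℝ)
    (hg : IsMetric g ginv) (hL : IsLorentzian g)
    (D : Set (Pt n)) (hD : IsOpen D) (hDne : D.Nonempty) (hsc : SimplyConnectedSpace D)
    (h2 : TwoSymmetricOn g ginv D)
    (hnk : ¬ ∃ k : Pt n → Fin n → ℝ, ParallelNullVectorFieldOn g ginv D k) :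
    (∀ x ∈ D, ∀ μ ν : Fin n, ricci g ginv x ![μ, ν] = 0) ∨
    (∀ x ∈ D, ∀ idx, covD g ginv (riemann g ginv) x idx = 0) := by
  right
  intro x hx idx
  have : NeZero n := ⟨fun h => (h ▸ idx 0 : Fin 0).elim0⟩
  have hLC := hg.isLeviCivita
  have hS : ∀ y ∈ D, IsTwoSymmetricAt (connForm g ginv) y :=
    fun y hy => hg.isTwoSymmetricAt (h2 y hy)
  have hpre : IsPreconnected D := by
    have : PreconnectedSpace D := inferInstance
    exact isPreconnected_iff_preconnectedSpace.2 this
  by_cases h0 : covCurv (connForm g ginv) x = 0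
  · rw [hg.covD_riemann_eq, h0]
    simp
  · obtain ⟨k, hk⟩ := hLC.exists_parallel_null hL.exists_isLorentzBasis hD hS fun y hy hy0 =>
      h0 (IsTwoSymmetricAt.covCurv_eq_zero hLC hD hpre hS hy hx hy0)
    refine absurd ⟨k, fun y hy l μ => ?_, fun y hy => ?_, fun y hy => (hk y hy).1⟩ hnk
    · rw [covDVec_eq (hk y hy).2.2.1, (hk y hy).2.2.2, Pi.zero_apply]
    · rw [← metricForm_apply, (hk y hy).2.1]
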